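/- arXiv:math/0503348 — 6 statements merged into one kernel-verified Lean document; each statement's English description precedes it below -/
import Mathlib

section
/- Let K be a Δ-field and ω = (w₁, w₂) ∈ K² with (w₁, w₂) ≠ (0, 0). The following are equivalent. (a) There exist a Δ-field extension E of K, a Riccati tower K = K₀ ⊆ K₁ ⊆ … ⊆ K_m = E of differential subfields, and an element H ∈ E with δ₁H·w₂ − δ₂H·w₁ = 0 and (δ₁H, δ₂H) ≠ (0, 0). (b) There exist A₁, A₂, B₁, B₂ ∈ K such that δ₁w₂ − δ₂w₁ = w₁·A₂ − w₂·A₁, δ₁A₂ − δ₂A₁ = w₁·B₂ − w₂·B₁, and δ₁B₂ − δ₂B₁ = A₁·B₂ − A₂·B₁ (1-forms α, β over K with dω = ω ∧ α, dα = ω ∧ β, dβ = α ∧ β: a Godbillon–Vey sequence of length three). -/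
open scoped BigOperators

/-- A Δ-field: a field of characteristic zero equipped with two commuting
derivations `d₁`, `d₂`. -/
structure DeltaField where
  carrier : Type
  [field : Field carrier]
  [charZero : CharZero carrier]
  d₁ : carrier → carrier
  d₂ : carrier → carrier
  d₁_add : ∀ x y, d₁ (x + y) = d₁ x + d₁ y
  d₁_mul : ∀ x y, d₁ (x * y) = d₁ x * y + x * d₁ y
  d₂_add : ∀ x y, d₂ (x + y) = d₂ x + d₂ y
  d₂_mul : ∀ x y, d₂ (x * y) = d₂ x * y + x * d₂ y
  comm : ∀ x, d₁ (d₂ x) = d₂ (d₁ x)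

attribute [instance] DeltaField.field DeltaField.charZero

/-- A differential subfield: a subfield closed under both derivations. -/
def DiffSubfield (E : DeltaField) (L : Subfield E.carrier) : Prop :=
  ∀ x ∈ L, E.d₁ x ∈ L ∧ E.d₂ x ∈ L

/-- `x` is algebraic over the subfield `L`: it satisfies a nonzero polynomial
relation with coefficients in `L`. -/
def AlgebraicOver (E : DeltaField) (L : Subfield E.carrier) (x : E.carrier) : Prop :=
  ∃ (k : ℕ) (c : Fin (k + 1) → E.carrier),
    (∀ j, c j ∈ L) ∧ (∃ j, c j ≠ 0) ∧ ∑ j, c j * x ^ (j : ℕ) = 0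

/-- An algebraic extension step `L ⊆ M`. -/
def AlgStep (E : DeltaField) (L M : Subfield E.carrier) : Prop :=
  ∀ x ∈ M, AlgebraicOver E L x

/-- A Riccati extension step: `M = L(G)` with `dⱼG = ½G²·eⱼ + G·cⱼ + dⱼ` for some
`eⱼ, cⱼ, dⱼ ∈ L` (`j = 1, 2`). -/
def RiccatiStep (E : DeltaField) (L M : Subfield E.carrier) : Prop :=
  ∃ (G e1 c1 f1 e2 c2 f2 : E.carrier),
    e1 ∈ L ∧ c1 ∈ L ∧ f1 ∈ L ∧ e2 ∈ L ∧ c2 ∈ L ∧ f2 ∈ L ∧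
    E.d₁ G = (1 / 2) * G ^ 2 * e1 + G * c1 + f1 ∧
    E.d₂ G = (1 / 2) * G ^ 2 * e2 + G * c2 + f2 ∧
    M = Subfield.closure ((L : Set E.carrier) ∪ {G})

/-- A Riccati tower over `K₀` inside `E`: a chain of differential subfields
`K₀ = Ks 0 ⊆ … ⊆ Ks m = E` in which each step is either algebraic or Riccati. -/
def RiccatiTower (E : DeltaField) (K₀ : Subfield E.carrier) : Prop :=
  ∃ (m : ℕ) (Ks : Fin (m + 1) → Subfield E.carrier),
    Ks 0 = K₀ ∧ Ks (Fin.last m) = ⊤ ∧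
    (∀ i, DiffSubfield E (Ks i)) ∧
    (∀ i : Fin m, Ks i.castSucc ≤ Ks i.succ ∧
      (AlgStep E (Ks i.castSucc) (Ks i.succ) ∨ RiccatiStep E (Ks i.castSucc) (Ks i.succ)))
open Polynomial

theorem Derivation.exists_extension_of_formallyEtale {A B : Type} [CommRing A] [CommRing B]
    [Algebra A B] [Algebra.FormallyEtale A B] (d : Derivation ℤ A A) :
    ∃ d' : Derivation ℤ B B, ∀ a, d' (algebraMap A B a) = algebraMap A B (d a) := by
  let f : Ω[A⁄ℤ] →ₗ[A] B := (Algebra.linearMap A B) ∘ₗ d.liftKaehlerDifferential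
  let g : Ω[B⁄ℤ] →ₗ[B] B := f.liftBaseChange B ∘ₗ
    (KaehlerDifferential.tensorKaehlerEquivOfFormallyEtale ℤ A B).symm.toLinearMap
  refine ⟨g.compDer (KaehlerDifferential.D ℤ B), fun a => ?_⟩
  simp [g, f, KaehlerDifferential.tensorKaehlerEquivOfFormallyEtale_symm_D_algebraMap]

theorem Derivation.eq_of_eq_on_algebraMap {A B : Type} [CommRing A] [CommRing B]
    [Algebra A B] [Algebra.FormallyUnramified A B] (d d' : Derivation ℤ B B)
    (h : ∀ a, d (algebraMap A B a) = d' (algebraMap A B a)) : d = d' := by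
  let δ : Derivation A B B := Derivation.mk'
    { toFun := fun x => d x - d' x
      map_add' := fun x y => by simp; ring
      map_smul' := fun a x => by
        simp only [Algebra.smul_def, leibniz, h, RingHom.id_apply, Algebra.algebraMap_self]
        ring }
    (fun x y => by
      simp only [LinearMap.coe_mk, AddHom.coe_mk, leibniz, smul_eq_mul]
      ring)
  have hδ : δ.liftKaehlerDifferential = 0 := by
    refine LinearMap.ext fun x => ?_
    rw [Subsingleton.elim x 0, map_zero, map_zero]
  ext x
  have : δ x = 0 := by
    rw [← δ.liftKaehlerDifferential_comp_D, hδ]; simp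
  exact sub_eq_zero.mp this

/-- The two derivations of a Δ-field, bundled. -/
def DeltaField.D₁ (E : DeltaField) : Derivation ℤ E.carrier E.carrier :=
  Derivation.mk' (AddMonoidHom.mk' E.d₁ E.d₁_add).toIntLinearMap fun x y => by
    simp [E.d₁_mul, mul_comm]; ring

def DeltaField.D₂ (E : DeltaField) : Derivation ℤ E.carrier E.carrier :=
  Derivation.mk' (AddMonoidHom.mk' E.d₂ E.d₂_add).toIntLinearMap fun x y => by
    simp [E.d₂_mul, mul_comm]; ring

abbrev DeltaField.ofDerivations (F : Type) [Field F] [CharZero F] (D D' : Derivation ℤ F F)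
    (h : ⁅D, D'⁆ = 0) : DeltaField where
  carrier := F
  d₁ := D
  d₂ := D'
  d₁_add := map_add D
  d₁_mul x y := by simp [mul_comm, add_comm]
  d₂_add := map_add D'
  d₂_mul x y := by simp [mul_comm, add_comm]
  comm x := by
    have := DFunLike.congr_fun h x
    rw [Derivation.commutator_apply] at this
    exact sub_eq_zero.mp this

theorem DeltaField.lie_eq_zero (E : DeltaField) : ⁅E.D₁, E.D₂⁆ = 0 := by
  ext x
  rw [Derivation.commutator_apply]
  exact sub_eq_zero.mpr (E.comm x)

/-- Two commuting derivations extend to a formally étale field extension. -/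
theorem DeltaField.exists_etale_extension (A F : Type) [CommRing A] [Field F] [CharZero F]
    [Algebra A F] [Algebra.FormallyEtale A F] (D D' : Derivation ℤ A A) (h : ⁅D, D'⁆ = 0) :
    ∃ δ δ' : Derivation ℤ F F, ⁅δ, δ'⁆ = 0 ∧
      (∀ a, δ (algebraMap A F a) = algebraMap A F (D a)) ∧
      (∀ a, δ' (algebraMap A F a) = algebraMap A F (D' a)) := by
  obtain ⟨δ, hδ⟩ := Derivation.exists_extension_of_formallyEtale (B := F) D
  obtain ⟨δ', hδ'⟩ := Derivation.exists_extension_of_formallyEtale (B := F) D'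
  refine ⟨δ, δ', ?_, hδ, hδ'⟩
  refine Derivation.eq_of_eq_on_algebraMap (A := A) _ _ fun a => ?_
  have := DFunLike.congr_fun h a
  simp only [Derivation.commutator_apply, hδ, hδ', Derivation.coe_zero, Pi.zero_apply] at this ⊢
  rw [← map_sub, this, map_zero]

theorem DeltaField.exists_algebraicClosure (E : DeltaField) :
    ∃ (F : DeltaField) (ι : E.carrier →+* F.carrier), IsAlgClosed F.carrier ∧
      (∀ y, ι.IsIntegralElem y) ∧
      (∀ x, ι (E.d₁ x) = F.d₁ (ι x)) ∧ (∀ x, ι (E.d₂ x) = F.d₂ (ι x)) := by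
  have := Algebra.FormallyEtale.of_isSeparable E.carrier (AlgebraicClosure E.carrier)
  have : CharZero (AlgebraicClosure E.carrier) :=
    charZero_of_injective_algebraMap (algebraMap E.carrier _).injective
  obtain ⟨δ, δ', h, h₁, h₂⟩ := DeltaField.exists_etale_extension E.carrier
    (AlgebraicClosure E.carrier) E.D₁ E.D₂ E.lie_eq_zero
  exact ⟨.ofDerivations _ δ δ' h, algebraMap E.carrier (AlgebraicClosure E.carrier),
    inferInstanceAs (IsAlgClosed (AlgebraicClosure E.carrier)),
    fun y => (AlgebraicClosure.isAlgebraic E.carrier).isAlgebraic y |>.isIntegral,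
    fun x => (h₁ x).symm, fun x => (h₂ x).symm⟩

/-- Adjoining a transcendental solution of an integrable Riccati system. -/
theorem DeltaField.exists_riccati_extension (K : DeltaField) (e₁ c₁ f₁ e₂ c₂ f₂ : K.carrier)
    (he : K.d₁ e₂ - K.d₂ e₁ = e₁ * c₂ - e₂ * c₁)
    (hc : K.d₁ c₂ - K.d₂ c₁ = e₁ * f₂ - e₂ * f₁)
    (hf : K.d₁ f₂ - K.d₂ f₁ = c₁ * f₂ - c₂ * f₁) :
    ∃ (E : DeltaField) (ι : K.carrier →+* E.carrier) (G : E.carrier),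
      (∀ x, ι (K.d₁ x) = E.d₁ (ι x)) ∧ (∀ x, ι (K.d₂ x) = E.d₂ (ι x)) ∧ G ≠ 0 ∧
      E.d₁ G = (1 / 2) * G ^ 2 * ι e₁ + G * ι c₁ + ι f₁ ∧
      E.d₂ G = (1 / 2) * G ^ 2 * ι e₂ + G * ι c₂ + ι f₂ ∧
      Subfield.closure ((ι.fieldRange : Set E.carrier) ∪ {G}) = ⊤ := by
  let P : K.carrier[X] := C (1 / 2) * X ^ 2 * C e₁ + X * C c₁ + C f₁
  let Q : K.carrier[X] := C (1 / 2) * X ^ 2 * C e₂ + X * C c₂ + C f₂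
  let D : Derivation ℤ K.carrier[X] K.carrier[X] :=
    @Differential.implicitDeriv K.carrier _ ⟨K.D₁⟩ P
  let D' : Derivation ℤ K.carrier[X] K.carrier[X] :=
    @Differential.implicitDeriv K.carrier _ ⟨K.D₂⟩ Q
  have hDC (a) : D (C a) = C (K.d₁ a) := @Differential.implicitDeriv_C K.carrier _ ⟨K.D₁⟩ P a
  have hDC' (a) : D' (C a) = C (K.d₂ a) := @Differential.implicitDeriv_C K.carrier _ ⟨K.D₂⟩ Q a
  have hDX : D X = P := @Differential.implicitDeriv_X K.carrier _ ⟨K.D₁⟩ P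
  have hDX' : D' X = Q := @Differential.implicitDeriv_X K.carrier _ ⟨K.D₂⟩ Q
  have half (δ : Derivation ℤ K.carrier K.carrier) : δ (1 / 2) = 0 := by
    have h2 : δ 2 = 0 := by exact_mod_cast δ.map_natCast 2
    rw [one_div, δ.leibniz_inv, h2, smul_zero]
  have h₁half : K.d₁ (1 / 2) = 0 := half K.D₁
  have h₂half : K.d₂ (1 / 2) = 0 := half K.D₂
  have hC2 : C (1 / 2 : K.carrier) * 2 = 1 := by
    rw [← C_ofNat, ← C_mul]; norm_num
  have hX : D Q - D' P = 0 := by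
    have he' := congrArg (C : K.carrier → K.carrier[X]) he
    have hc' := congrArg (C : K.carrier → K.carrier[X]) hc
    have hf' := congrArg (C : K.carrier → K.carrier[X]) hf
    simp only [C_sub, C_mul] at he' hc' hf'
    simp only [P, Q, map_add, Derivation.leibniz, hDC, hDC', hDX, hDX', h₁half, h₂half, smul_eq_mul,
      Derivation.leibniz_pow, C_0]
    simp only [nsmul_eq_mul, Nat.cast_ofNat, pow_one, Nat.add_one_sub_one]
    linear_combination (C (1 / 2) * X ^ 2) * he' + X * hc' + hf' +
      ((C e₂ * X) * (C (1 / 2) * X ^ 2 * C e₁ + X * C c₁ + C f₁) -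
        (C e₁ * X) * (C (1 / 2) * X ^ 2 * C e₂ + X * C c₂ + C f₂) +
        X ^ 2 * (C e₁ * C c₂ - C e₂ * C c₁)) * hC2
  have hlie : ⁅D, D'⁆ = 0 := by
    have hlX : ⁅D, D'⁆ X = 0 := by rw [Derivation.commutator_apply, hDX, hDX', hX]
    have hlC (a) : ⁅D, D'⁆ (C a) = 0 := by
      simp only [Derivation.commutator_apply, hDC, hDC', K.comm, sub_self]
    refine Derivation.ext fun p => ?_
    induction p using Polynomial.induction_on' with
    | add p q hp hq => rw [map_add, hp, hq]; simp
    | monomial n a =>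
      rw [← C_mul_X_pow_eq_monomial, Derivation.leibniz, Derivation.leibniz_pow, hlX, hlC]
      simp
  have : Algebra.FormallyEtale K.carrier[X] (FractionRing K.carrier[X]) :=
    .of_isLocalization (nonZeroDivisors K.carrier[X])
  have : CharZero (FractionRing K.carrier[X]) :=
    charZero_of_injective_algebraMap
      (IsFractionRing.injective K.carrier[X] (FractionRing K.carrier[X]))
  obtain ⟨δ, δ', h, h₁, h₂⟩ := DeltaField.exists_etale_extension K.carrier[X]
    (FractionRing K.carrier[X]) D D' hlie
  let j := algebraMap K.carrier[X] (FractionRing K.carrier[X])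
  have hj : Function.Injective j := IsFractionRing.injective _ _
  have hjhalf : j (C (1 / 2)) = 1 / 2 := by
    rw [eq_div_iff two_ne_zero, ← map_ofNat j 2, ← map_mul, hC2, map_one]
  refine ⟨.ofDerivations _ δ δ' h, j.comp C, j X, fun x => ?_, fun x => ?_, ?_, ?_, ?_, ?_⟩
  · exact (congrArg j (hDC x)).symm.trans (h₁ (C x)).symm
  · exact (congrArg j (hDC' x)).symm.trans (h₂ (C x)).symm
  · exact (map_ne_zero_iff j hj).mpr X_ne_zero
  · refine (h₁ X).trans ((congrArg j hDX).trans ?_)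
    simp only [P, map_add, map_mul, map_pow, RingHom.comp_apply]
    rw [← hjhalf]
  · refine (h₂ X).trans ((congrArg j hDX').trans ?_)
    simp only [Q, map_add, map_mul, map_pow, RingHom.comp_apply]
    rw [← hjhalf]
  · have hmem (p : K.carrier[X]) :
        j p ∈ Subfield.closure (((j.comp C).fieldRange : Set (FractionRing K.carrier[X])) ∪
          {j X}) := by
      induction p using Polynomial.induction_on' with
      | add p q hp hq => rw [map_add]; exact add_mem hp hq
      | monomial n a =>
        rw [← C_mul_X_pow_eq_monomial, map_mul, map_pow]
        exact mul_mem (Subfield.subset_closure (.inl ⟨a, rfl⟩))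
          (pow_mem (Subfield.subset_closure (.inr rfl)) n)
    refine eq_top_iff.mpr fun x _ => ?_
    obtain ⟨p, q, -, rfl⟩ := IsFractionRing.div_surjective (A := K.carrier[X]) x
    exact div_mem (hmem p) (hmem q)

theorem DiffSubfield.fieldRange {K E : DeltaField} (ι : K.carrier →+* E.carrier)
    (h₁ : ∀ x, ι (K.d₁ x) = E.d₁ (ι x)) (h₂ : ∀ x, ι (K.d₂ x) = E.d₂ (ι x)) :
    DiffSubfield E ι.fieldRange := by
  rintro _ ⟨x, rfl⟩
  exact ⟨⟨K.d₁ x, h₁ x⟩, ⟨K.d₂ x, h₂ x⟩⟩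

/-- A Riccati extension remains a Riccati step after a further extension. -/
theorem RiccatiStep.fieldRange_comp {K L E : DeltaField} (ι : K.carrier →+* L.carrier)
    (φ : L.carrier →+* E.carrier)
    (h₁ : ∀ x, φ (L.d₁ x) = E.d₁ (φ x)) (h₂ : ∀ x, φ (L.d₂ x) = E.d₂ (φ x))
    (G : L.carrier) (e₁ c₁ f₁ e₂ c₂ f₂ : K.carrier)
    (hG₁ : L.d₁ G = (1 / 2) * G ^ 2 * ι e₁ + G * ι c₁ + ι f₁)
    (hG₂ : L.d₂ G = (1 / 2) * G ^ 2 * ι e₂ + G * ι c₂ + ι f₂)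
    (htop : Subfield.closure ((ι.fieldRange : Set L.carrier) ∪ {G}) = ⊤) :
    RiccatiStep E (φ.comp ι).fieldRange φ.fieldRange := by
  refine ⟨φ G, φ (ι e₁), φ (ι c₁), φ (ι f₁), φ (ι e₂), φ (ι c₂), φ (ι f₂), ⟨_, rfl⟩, ⟨_, rfl⟩,
    ⟨_, rfl⟩, ⟨_, rfl⟩, ⟨_, rfl⟩, ⟨_, rfl⟩, ?_, ?_, ?_⟩
  · rw [← h₁, hG₁]; simp [map_ofNat φ 2]
  · rw [← h₂, hG₂]; simp [map_ofNat φ 2]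
  · rw [RingHom.fieldRange_eq_map, ← htop, RingHom.map_field_closure]
    congr 1
    ext x
    simp [eq_comm (a := x)]

theorem DeltaField.exists_first_integral_of_GV (K : DeltaField) (w₁ w₂ : K.carrier)
    (hw : ¬(w₁ = 0 ∧ w₂ = 0)) (A₁ A₂ B₁ B₂ : K.carrier)
    (hω : K.d₁ w₂ - K.d₂ w₁ = w₁ * A₂ - w₂ * A₁)
    (hα : K.d₁ A₂ - K.d₂ A₁ = w₁ * B₂ - w₂ * B₁)
    (hβ : K.d₁ B₂ - K.d₂ B₁ = A₁ * B₂ - A₂ * B₁) :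
    ∃ (E : DeltaField) (ι : K.carrier →+* E.carrier),
      (∀ x, ι (K.d₁ x) = E.d₁ (ι x)) ∧ (∀ x, ι (K.d₂ x) = E.d₂ (ι x)) ∧
      RiccatiTower E ι.fieldRange ∧
      ∃ H : E.carrier,
        E.d₁ H * ι w₂ - E.d₂ H * ι w₁ = 0 ∧ ¬(E.d₁ H = 0 ∧ E.d₂ H = 0) := by
  obtain ⟨L, ι, G, hι₁, hι₂, -, hG₁, hG₂, hGtop⟩ :=
    K.exists_riccati_extension w₁ A₁ B₁ w₂ A₂ B₂ hω hα hβ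
  have hω' := congrArg ι hω
  have hα' := congrArg ι hα
  simp only [map_sub, map_mul, hι₁, hι₂] at hω' hα'
  have zero₁ (E : DeltaField) : E.d₁ 0 = 0 := map_zero E.D₁
  have zero₂ (E : DeltaField) : E.d₂ 0 = 0 := map_zero E.D₂
  obtain ⟨M, κ, F, hκ₁, hκ₂, hF, hF₁, hF₂, hFtop⟩ :=
    L.exists_riccati_extension 0 (ι A₁ + G * ι w₁) 0 0 (ι A₂ + G * ι w₂) 0
      (by simp [zero₁, zero₂])
      (by
        rw [L.d₁_add, L.d₂_add, L.d₁_mul, L.d₂_mul, hG₁, hG₂]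
        linear_combination hα' + G * hω')
      (by simp [zero₁, zero₂])
  have hω'' := congrArg κ hω'
  simp only [map_sub, map_mul, map_add, map_zero, hκ₁, hκ₂] at hω'' hF₁ hF₂
  obtain ⟨E, μ, H, hμ₁, hμ₂, -, hH₁, hH₂, hHtop⟩ :=
    M.exists_riccati_extension 0 0 (F * κ (ι w₁)) 0 0 (F * κ (ι w₂))
      (by simp [zero₁, zero₂]) (by simp [zero₁, zero₂])
      (by
        rw [M.d₁_mul, M.d₂_mul, hF₁, hF₂]
        linear_combination F * hω'')
  have hμκ₁ (x) : μ.comp κ (L.d₁ x) = E.d₁ (μ.comp κ x) := by simp [hκ₁, hμ₁]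
  have hμκ₂ (x) : μ.comp κ (L.d₂ x) = E.d₂ (μ.comp κ x) := by simp [hκ₂, hμ₂]
  have hμκι₁ (x) : (μ.comp κ).comp ι (K.d₁ x) = E.d₁ ((μ.comp κ).comp ι x) := by
    simp [hι₁, hκ₁, hμ₁]
  have hμκι₂ (x) : (μ.comp κ).comp ι (K.d₂ x) = E.d₂ ((μ.comp κ).comp ι x) := by
    simp [hι₂, hκ₂, hμ₂]
  have hid : (RingHom.id E.carrier).fieldRange = ⊤ :=
    RingHom.fieldRange_eq_top_iff.mpr Function.surjective_id
  refine ⟨E, (μ.comp κ).comp ι, hμκι₁, hμκι₂, ⟨3, ![((μ.comp κ).comp ι).fieldRange,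
    (μ.comp κ).fieldRange, μ.fieldRange, (RingHom.id E.carrier).fieldRange], rfl, hid, ?_, ?_⟩,
    H, ?_, ?_⟩
  · intro i
    fin_cases i
    · exact .fieldRange _ hμκι₁ hμκι₂
    · exact .fieldRange _ hμκ₁ hμκ₂
    · exact .fieldRange _ hμ₁ hμ₂
    · exact .fieldRange (K := E) (RingHom.id E.carrier) (fun _ => rfl) (fun _ => rfl)
  · intro i
    fin_cases i
    · refine ⟨?_, .inr (.fieldRange_comp ι (μ.comp κ) hμκ₁ hμκ₂ G _ _ _ _ _ _ hG₁ hG₂ hGtop)⟩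
      rintro _ ⟨x, rfl⟩
      exact ⟨ι x, rfl⟩
    · refine ⟨?_, .inr (.fieldRange_comp κ μ hμ₁ hμ₂ F 0 (ι A₁ + G * ι w₁) 0 0 (ι A₂ + G * ι w₂) 0
        (by simpa using hF₁) (by simpa using hF₂) hFtop)⟩
      rintro _ ⟨x, rfl⟩
      exact ⟨κ x, rfl⟩
    · refine ⟨?_, .inr (.fieldRange_comp (L := E) μ (RingHom.id E.carrier) (fun _ => rfl)
        (fun _ => rfl) H _ _ _ _ _ _ hH₁ hH₂ hHtop)⟩
      rintro _ ⟨x, rfl⟩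
      exact ⟨μ x, rfl⟩
  · rw [hH₁, hH₂]
    simp
    ring
  · rw [hH₁, hH₂]
    simpa [hF] using hw

/-- The equations of a Godbillon–Vey sequence of length three for `(w₁, w₂)` over `K`. -/
def DeltaField.HasGV (K : DeltaField) (w₁ w₂ : K.carrier) : Prop :=
  ∃ A₁ A₂ B₁ B₂ : K.carrier,
    K.d₁ w₂ - K.d₂ w₁ = w₁ * A₂ - w₂ * A₁ ∧
    K.d₁ A₂ - K.d₂ A₁ = w₁ * B₂ - w₂ * B₁ ∧
    K.d₁ B₂ - K.d₂ B₁ = A₁ * B₂ - A₂ * B₁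

/-- The derivation `w₂ δ₁ - w₁ δ₂`, tangent to the foliation of `(w₁, w₂)`. -/
def DeltaField.tangent (K : DeltaField) (w₁ w₂ : K.carrier) :
    Derivation ℤ K.carrier K.carrier :=
  w₂ • K.D₁ - w₁ • K.D₂

theorem DeltaField.tangent_apply (K : DeltaField) (w₁ w₂ x : K.carrier) :
    K.tangent w₁ w₂ x = w₂ * K.d₁ x - w₁ * K.d₂ x := rfl

theorem DeltaField.d₁_sub (K : DeltaField) (x y : K.carrier) :
    K.d₁ (x - y) = K.d₁ x - K.d₁ y := map_sub K.D₁ x y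

theorem DeltaField.d₂_sub (K : DeltaField) (x y : K.carrier) :
    K.d₂ (x - y) = K.d₂ x - K.d₂ y := map_sub K.D₂ x y

theorem DeltaField.d₁_neg (K : DeltaField) (x : K.carrier) : K.d₁ (-x) = -K.d₁ x :=
  map_neg K.D₁ x

theorem DeltaField.d₂_neg (K : DeltaField) (x : K.carrier) : K.d₂ (-x) = -K.d₂ x :=
  map_neg K.D₂ x

theorem DeltaField.d₁_natCast (K : DeltaField) (n : ℕ) : K.d₁ n = 0 := K.D₁.map_natCast n

theorem DeltaField.d₂_natCast (K : DeltaField) (n : ℕ) : K.d₂ n = 0 := K.D₂.map_natCast n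

theorem DeltaField.d₁_inv (K : DeltaField) (x : K.carrier) : K.d₁ x⁻¹ = -(x⁻¹) ^ 2 * K.d₁ x := by
  simpa using! K.D₁.leibniz_inv x

theorem DeltaField.d₂_inv (K : DeltaField) (x : K.carrier) : K.d₂ x⁻¹ = -(x⁻¹) ^ 2 * K.d₂ x := by
  simpa using! K.D₂.leibniz_inv x

theorem DeltaField.d₁_half (K : DeltaField) : K.d₁ (1 / 2) = 0 := by
  have := K.d₁_natCast 2
  rw [one_div, K.d₁_inv, ← Nat.cast_ofNat, this, mul_zero]

theorem DeltaField.d₂_half (K : DeltaField) : K.d₂ (1 / 2) = 0 := by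
  have := K.d₂_natCast 2
  rw [one_div, K.d₂_inv, ← Nat.cast_ofNat, this, mul_zero]

/-- A nonzero pair wedges onto every scalar. -/
theorem exists_wedge_eq {F : Type} [Field F] {w₁ w₂ : F} (hw : ¬(w₁ = 0 ∧ w₂ = 0)) (r : F) :
    ∃ a₁ a₂, r = w₁ * a₂ - w₂ * a₁ := by
  by_cases h : w₁ = 0
  · have h2 : w₂ ≠ 0 := fun h' => hw ⟨h, h'⟩
    exact ⟨-r / w₂, 0, by field_simp; ring⟩
  · exact ⟨0, r / w₁, by field_simp; ring⟩

/-- A pair whose wedge with a nonzero pair vanishes is a multiple of it. -/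
theorem exists_eq_mul_of_wedge_eq_zero {F : Type} [Field F] {w₁ w₂ : F}
    (hw : ¬(w₁ = 0 ∧ w₂ = 0)) {a₁ a₂ : F} (h : a₁ * w₂ - a₂ * w₁ = 0) :
    ∃ k, a₁ = k * w₁ ∧ a₂ = k * w₂ := by
  by_cases h1 : w₁ = 0
  · have h2 : w₂ ≠ 0 := fun h' => hw ⟨h1, h'⟩
    subst h1
    refine ⟨a₂ / w₂, ?_, by field_simp⟩
    simpa [h2] using h
  · refine ⟨a₁ / w₁, by field_simp, ?_⟩
    field_simp
    linear_combination -h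

/-- Once the first two equations hold for a choice of `α` and `β`, Godbillon–Vey sequences of
length three correspond to solutions of a first-order linear equation along the foliation. -/
theorem DeltaField.hasGV_iff (K : DeltaField) {w₁ w₂ : K.carrier} (hw : ¬(w₁ = 0 ∧ w₂ = 0))
    {A₁ A₂ B₁ B₂ : K.carrier} (hω : K.d₁ w₂ - K.d₂ w₁ = w₁ * A₂ - w₂ * A₁)
    (hα : K.d₁ A₂ - K.d₂ A₁ = w₁ * B₂ - w₂ * B₁) :
    K.HasGV w₁ w₂ ↔ ∃ h, K.tangent w₁ w₂ h = 2 * (A₁ * w₂ - A₂ * w₁) * h +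
      (A₁ * B₂ - A₂ * B₁ - (K.d₁ B₂ - K.d₂ B₁)) := by
  constructor
  · rintro ⟨A₁', A₂', B₁', B₂', hω', hα', hβ'⟩
    obtain ⟨g, hg₁, hg₂⟩ := exists_eq_mul_of_wedge_eq_zero hw
      (a₁ := A₁ - A₁') (a₂ := A₂ - A₂') (by linear_combination hω - hω')
    obtain rfl : A₁ = A₁' + g * w₁ := by linear_combination hg₁
    obtain rfl : A₂ = A₂' + g * w₂ := by linear_combination hg₂
    simp only [K.d₁_add, K.d₂_add, K.d₁_mul, K.d₂_mul] at hα
    obtain ⟨h, hh₁, hh₂⟩ := exists_eq_mul_of_wedge_eq_zero hw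
      (a₁ := B₁' - K.d₁ g + g * A₁' + 1 / 2 * (g * g) * w₁ - B₁)
      (a₂ := B₂' - K.d₂ g + g * A₂' + 1 / 2 * (g * g) * w₂ - B₂)
      (by linear_combination -hα + hα' + g * hω')
    refine ⟨h, ?_⟩
    obtain rfl : B₁ = B₁' - K.d₁ g + g * A₁' + 1 / 2 * (g * g) * w₁ - h * w₁ := by
      linear_combination -hh₁
    obtain rfl : B₂ = B₂' - K.d₂ g + g * A₂' + 1 / 2 * (g * g) * w₂ - h * w₂ := by
      linear_combination -hh₂
    simp only [K.tangent_apply, K.d₁_add, K.d₂_add, K.d₁_sub, K.d₂_sub, K.d₁_mul, K.d₂_mul,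
      K.d₁_half, K.d₂_half, K.comm]
    linear_combination hβ' + g * hα' + (1 / 2 * g * g - h) * hω'
  · rintro ⟨h, hh⟩
    refine ⟨A₁, A₂, B₁ + h * w₁, B₂ + h * w₂, hω, by linear_combination hα, ?_⟩
    simp only [K.tangent_apply, K.d₁_add, K.d₂_add, K.d₁_mul, K.d₂_mul] at hh ⊢
    linear_combination hh + h * hω

theorem DeltaField.HasGV.of_mul (K : DeltaField) {w₁ w₂ k : K.carrier} (hk : k ≠ 0)
    (h : K.HasGV (k * w₁) (k * w₂)) : K.HasGV w₁ w₂ := by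
  obtain ⟨A₁, A₂, B₁, B₂, hω, hα, hβ⟩ := h
  simp only [K.d₁_mul, K.d₂_mul] at hω
  have hkk : k * k⁻¹ = 1 := mul_inv_cancel₀ hk
  refine ⟨A₁ + K.d₁ k * k⁻¹, A₂ + K.d₂ k * k⁻¹, k * B₁, k * B₂, ?_, ?_, ?_⟩
  · linear_combination k⁻¹ * hω - (K.d₁ w₂ - K.d₂ w₁ - (w₁ * A₂ - w₂ * A₁)) * hkk
  · simp only [K.d₁_add, K.d₂_add, K.d₁_mul, K.d₂_mul, K.d₁_inv, K.d₂_inv, K.comm]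
    linear_combination hα
  · simp only [K.d₁_mul, K.d₂_mul]
    linear_combination k * hβ - (K.d₁ k * B₂ - K.d₂ k * B₁) * hkk

/-- A logarithmic derivative in the tangent direction yields a closed `α`. -/
theorem DeltaField.hasGV_of_closed (K : DeltaField) {w₁ w₂ A₁ A₂ c₁ c₂ s m : K.carrier}
    (hω : K.d₁ w₂ - K.d₂ w₁ = w₁ * A₂ - w₂ * A₁) (hc : K.d₁ c₂ - K.d₂ c₁ = 0)
    (hm₁ : K.d₁ m = 0) (hm₂ : K.d₂ m = 0) (hs : s ≠ 0)
    (hX : K.tangent w₁ w₂ s = (2 * (A₁ * w₂ - A₂ * w₁) + m * (c₁ * w₂ - c₂ * w₁)) * s) :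
    K.HasGV w₁ w₂ := by
  have hss : s * s⁻¹ = 1 := mul_inv_cancel₀ hs
  have zero₁ : K.d₁ 0 = 0 := map_zero K.D₁
  have zero₂ : K.d₂ 0 = 0 := map_zero K.D₂
  refine ⟨1 / 2 * (K.d₁ s * s⁻¹ - m * c₁), 1 / 2 * (K.d₂ s * s⁻¹ - m * c₂), 0, 0, ?_, ?_, ?_⟩
  · rw [K.tangent_apply] at hX
    linear_combination hω + 1 / 2 * s⁻¹ * hX +
      1 / 2 * (2 * (A₁ * w₂ - A₂ * w₁) + m * (c₁ * w₂ - c₂ * w₁)) * hss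
  · simp only [K.d₁_sub, K.d₂_sub, K.d₁_mul, K.d₂_mul, K.d₁_inv, K.d₂_inv, K.comm, K.d₁_half,
      K.d₂_half, hm₁, hm₂]
    linear_combination (-1 / 2) * m * hc
  · simp [zero₁, zero₂]

open scoped Differential in
/-- A first-order linear equation with an algebraic solution has a solution in the base field. -/
theorem Differential.exists_linear_solution_of_isAlgebraic {F M : Type} [Field F] [CharZero F]
    [Field M] [Differential F] [Differential M] [Algebra F M] [DifferentialAlgebra F M]
    {a b : F} {h : M} (halg : IsAlgebraic F h)
    (hh : h′ = algebraMap F M a * h + algebraMap F M b) : ∃ x : F, x′ = a * x + b := by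
  set p := minpoly F h with hp
  have hmon : p.Monic := minpoly.monic halg.isIntegral
  have hdeg : 0 < p.natDegree := minpoly.natDegree_pos halg.isIntegral
  obtain ⟨n, hn⟩ : ∃ n, p.natDegree = n + 1 := ⟨p.natDegree - 1, by omega⟩
  have hn0 : ((n : F) + 1) ≠ 0 := by exact_mod_cast n.succ_ne_zero
  have hlead : p.coeff (n + 1) = 1 := by rw [← hn]; exact hmon
  have hbig : p.coeff (n + 2) = 0 := coeff_eq_zero_of_natDegree_lt (by omega)
  set q : F[X] := mapCoeffs p + derivative p * (C a * X + C b) - C (a * (n + 1)) * p with hq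
  have hq0 : aeval h q = 0 := by
    have h1 := deriv_aeval_eq h p
    rw [hp, minpoly.aeval, map_zero, ← hp, hh] at h1
    simp only [hq, map_sub, map_add, map_mul, aeval_C, aeval_X]
    rw [← h1, hp, minpoly.aeval, mul_zero, sub_zero]
  have hqc (i : ℕ) : q.coeff i = (p.coeff i)′ + i * p.coeff i * a + p.coeff (i + 1) * (i + 1) * b -
      a * (n + 1) * p.coeff i := by
    simp only [hq, mul_add, coeff_sub, coeff_add, coeff_mapCoeffs, ← mul_assoc, coeff_mul_C,
      coeff_derivative, coeff_C_mul]
    rcases i with _ | i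
    · simp
    · simp [coeff_mul_X, coeff_derivative]; ring
  have hqdeg : q.degree < p.degree := by
    rw [degree_eq_natDegree hmon.ne_zero, hn, degree_lt_iff_coeff_zero]
    intro m hm
    rw [hqc]
    rcases hm.eq_or_lt with rfl | hm
    · rw [hlead, hbig]; push_cast; simp; ring
    · rw [coeff_eq_zero_of_natDegree_lt (by omega : p.natDegree < m),
        coeff_eq_zero_of_natDegree_lt (by omega : p.natDegree < m + 1)]
      simp
  have hqz : q = 0 := by
    by_contra hne
    exact absurd (minpoly.degree_le_of_ne_zero F h hne hq0) (not_le.mpr hqdeg)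
  have hc := hqc n
  rw [hqz, coeff_zero, hlead] at hc
  refine ⟨-(p.coeff n) / (n + 1), ?_⟩
  have hder : ((n : F) + 1)′ = 0 := by
    have := Derivation.map_natCast (Differential.deriv (R := F)) (n + 1)
    exact_mod_cast this
  rw [Derivation.leibniz_div, hder, map_neg]
  simp only [smul_eq_mul]
  field_simp
  linear_combination (n + 1) * hc

open scoped Differential in
theorem Differential.eval_implicitDeriv {F : Type} [Field F] [Differential F] (v p : F[X]) (g : F) :
    eval g (implicitDeriv v p) = (eval g p)′ + (eval g v - g′) * eval g (derivative p) := by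
  have := deriv_aeval_eq g p
  simp only [coe_aeval_eq_eval] at this
  rw [this]
  simp [implicitDeriv]
  ring

open scoped Differential in
/-- A finite pole of a rational solution of a linear equation is a solution of the Riccati equation,
and the leading coefficient satisfies a homogeneous linear equation. -/
theorem Differential.riccati_of_pole {F : Type} [Field F] [CharZero F] [Differential F]
    {a b ε γ φ g : F} {N D : F[X]} (hD : D ≠ 0) (hND : IsCoprime N D) (hg : D.IsRoot g)
    (h : implicitDeriv (C ε * X ^ 2 + C γ * X + C φ) N * D -
      N * implicitDeriv (C ε * X ^ 2 + C γ * X + C φ) D = (C a * N + C b * D) * D) :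
    g′ = ε * g ^ 2 + γ * g + φ ∧
      ∃ s ≠ 0, ∃ n : ℕ, s′ = (a + n * (2 * ε * g + γ)) * s := by
  set v : F[X] := C ε * X ^ 2 + C γ * X + C φ with hv
  set t : F[X] := X - C g with ht
  have htg : eval g t = 0 := by simp [ht]
  have ht0 : t ≠ 0 := X_sub_C_ne_zero g
  obtain ⟨D₁, hDD, hD₁⟩ := exists_eq_pow_rootMultiplicity_mul_and_not_dvd D hD g
  have hpos : 0 < D.rootMultiplicity g := (rootMultiplicity_pos hD).mpr hg
  obtain ⟨n, hn⟩ : ∃ n, D.rootMultiplicity g = n + 1 := ⟨D.rootMultiplicity g - 1, by omega⟩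
  rw [hn, ← ht] at hDD
  have hδ : eval g D₁ ≠ 0 := fun h0 => hD₁ (dvd_iff_isRoot.mpr h0)
  have hν : eval g N ≠ 0 := by
    intro h0
    obtain ⟨u, w, huw⟩ := hND
    have := congrArg (eval g) huw
    simp [h0, hg.eq_zero] at this
  have hvt : implicitDeriv v t = t * (C ε * (X + C g) + C γ) + C (eval g v - g′) := by
    simp only [ht, map_sub, implicitDeriv_X, implicitDeriv_C]
    simp only [hv, eval_add, eval_mul, eval_C, eval_pow, eval_X, C_add, C_mul, C_pow]
    ring
  set q : F[X] := C ε * (X + C g) + C γ with hq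
  set ψ : F := eval g v - g′ with hψ
  have key : implicitDeriv v N * (t * D₁) - N * ((n + 1) * (t * q + C ψ) * D₁ +
      t * implicitDeriv v D₁) = (C a * N + C b * D) * (t * D₁) := by
    have hDder : implicitDeriv v D = t ^ n * ((n + 1) * (t * q + C ψ) * D₁ +
        t * implicitDeriv v D₁) := by
      rw [hDD, Derivation.leibniz, Derivation.leibniz_pow, hvt]
      simp only [smul_eq_mul, nsmul_eq_mul, Nat.add_sub_cancel]
      push_cast
      ring
    refine mul_left_cancel₀ (pow_ne_zero n ht0) ?_
    rw [hDder] at h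
    have hD' : D = t ^ n * (t * D₁) := by rw [hDD]; ring
    linear_combination h - (implicitDeriv v N - (C a * N + C b * D)) * hD'
  have hn0 : ((n : F) + 1) ≠ 0 := by exact_mod_cast n.succ_ne_zero
  have hψ0 : ψ = 0 := by
    have := congrArg (eval g) key
    simp only [eval_sub, eval_mul, eval_add, htg, eval_C, eval_natCast, eval_one] at this
    have h2 : eval g N * eval g D₁ * (n + 1) * ψ = 0 := by linear_combination -this
    simpa [hν, hδ, hn0] using h2
  refine ⟨?_, eval g N / eval g D₁, div_ne_zero hν hδ, n + 1, ?_⟩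
  · have : eval g v = ε * g ^ 2 + γ * g + φ := by simp [hv]
    linear_combination this - hψ0 + hψ
  · have key' : implicitDeriv v N * D₁ - N * ((n + 1) * q * D₁ + implicitDeriv v D₁) =
        (C a * N + C b * D) * D₁ := by
      refine mul_left_cancel₀ ht0 ?_
      rw [hψ0, C_0] at key
      linear_combination key
    have := congrArg (eval g) key'
    simp only [eval_sub, eval_mul, eval_add, eval_C, eval_natCast, eval_one, eval_implicitDeriv,
      ← hψ, hψ0, hg.eq_zero, hq, eval_X] at this
    rw [Derivation.leibniz_div]
    simp only [smul_eq_mul]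
    push_cast
    field_simp
    linear_combination this

open scoped Differential in
/-- A nonconstant polynomial solution of a linear equation forces the Riccati equation to be
linear, and the leading coefficient satisfies a homogeneous linear equation. -/
theorem Differential.riccati_of_polynomial {F : Type} [Field F] [CharZero F] [Differential F]
    {a b ε γ φ : F} {N : F[X]} (hN : N.natDegree ≠ 0)
    (h : implicitDeriv (C ε * X ^ 2 + C γ * X + C φ) N = C a * N + C b) :
    ε = 0 ∧ ∃ s ≠ 0, ∃ n : ℕ, s′ = (a - n * γ) * s := by
  obtain ⟨n, hn⟩ : ∃ n, N.natDegree = n + 1 := ⟨N.natDegree - 1, by omega⟩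
  have hlead : N.coeff (n + 1) ≠ 0 := by
    rw [← hn]
    exact leadingCoeff_ne_zero.mpr fun h0 => hN (by simp [h0])
  have hbig (m) (hm : n + 1 < m) : N.coeff m = 0 := coeff_eq_zero_of_natDegree_lt (by omega)
  have hn0 : ((n : F) + 1) ≠ 0 := by exact_mod_cast n.succ_ne_zero
  have hexp : implicitDeriv (C ε * X ^ 2 + C γ * X + C φ) N = mapCoeffs N +
      (C ε * (derivative N * X ^ 2) + C γ * (derivative N * X) + C φ * derivative N) := by
    simp only [implicitDeriv, Derivation.add_apply, Derivation.smul_apply,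
      Derivation.restrictScalars_apply, derivative'_apply, smul_eq_mul]
    ring
  rw [hexp] at h
  have h2 := congrArg (coeff · (n + 2)) h
  have h1 := congrArg (coeff · (n + 1)) h
  simp only [coeff_add, coeff_C_mul, coeff_mapCoeffs, coeff_mul_X_pow', coeff_derivative,
    coeff_C_succ, hbig (n + 2) (by omega), hbig (n + 2 + 1) (by omega),
    show n + 2 = (n + 1) + 1 from rfl, coeff_mul_X] at h1 h2
  have hε : ε = 0 := by
    simp [hlead, hn0] at h2
    exact h2
  subst hε
  refine ⟨rfl, N.coeff (n + 1), hlead, n + 1, ?_⟩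
  simp at h1
  push_cast
  linear_combination h1

/-- Over an algebraically closed Δ-field, a rational solution of the linear equation in a
transcendental solution of an integrable Riccati system yields a Godbillon–Vey sequence. -/
theorem DeltaField.hasGV_of_rational_solution (F : DeltaField) [IsAlgClosed F.carrier]
    {w₁ w₂ : F.carrier} (hw : ¬(w₁ = 0 ∧ w₂ = 0)) {A₁ A₂ B₁ B₂ : F.carrier}
    (hω : F.d₁ w₂ - F.d₂ w₁ = w₁ * A₂ - w₂ * A₁)
    (hα : F.d₁ A₂ - F.d₂ A₁ = w₁ * B₂ - w₂ * B₁)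
    {e₁ c₁ f₁ e₂ c₂ f₂ : F.carrier}
    (he : F.d₁ e₂ - F.d₂ e₁ = e₁ * c₂ - e₂ * c₁)
    (hc : F.d₁ c₂ - F.d₂ c₁ = e₁ * f₂ - e₂ * f₁)
    (hf : F.d₁ f₂ - F.d₂ f₁ = c₁ * f₂ - c₂ * f₁)
    {N D : F.carrier[X]} (hD : D.Monic) (hND : IsCoprime N D)
    (h : letI : Differential F.carrier := ⟨F.tangent w₁ w₂⟩
      letI v : F.carrier[X] := C (1 / 2 * (e₁ * w₂ - e₂ * w₁)) * X ^ 2 +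
        C (c₁ * w₂ - c₂ * w₁) * X + C (f₁ * w₂ - f₂ * w₁)
      Differential.implicitDeriv v N * D - N * Differential.implicitDeriv v D =
        (C (2 * (A₁ * w₂ - A₂ * w₁)) * N +
          C (A₁ * B₂ - A₂ * B₁ - (F.d₁ B₂ - F.d₂ B₁)) * D) * D) :
    F.HasGV w₁ w₂ := by
  let : Differential F.carrier := ⟨F.tangent w₁ w₂⟩
  by_cases hD0 : D.natDegree = 0
  · obtain rfl : D = 1 := hD.natDegree_eq_zero.mp hD0
    simp only [mul_one, Derivation.map_one_eq_zero, mul_zero, sub_zero] at h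
    by_cases hN : N.natDegree = 0
    · obtain ⟨x, rfl⟩ := natDegree_eq_zero.mp hN
      rw [Differential.implicitDeriv_C, ← C_mul, ← C_add] at h
      exact (F.hasGV_iff hw hω hα).mpr ⟨x, C_injective h⟩
    · obtain ⟨hε, s, hs, n, hsn⟩ := Differential.riccati_of_polynomial hN h
      obtain ⟨k, rfl, rfl⟩ := exists_eq_mul_of_wedge_eq_zero hw (a₁ := e₁) (a₂ := e₂)
        (by linear_combination 2 * hε)
      by_cases hk : k = 0
      · subst hk
        refine F.hasGV_of_closed (m := -n) hω (hc.trans (by ring)) ?_ ?_ hs (hsn.trans (by ring))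
        · rw [F.d₁_neg, F.d₁_natCast, neg_zero]
        · rw [F.d₂_neg, F.d₂_natCast, neg_zero]
      · exact .of_mul F hk ⟨c₁, c₂, f₁, f₂, he, hc, hf⟩
  · obtain ⟨g, hg⟩ := IsAlgClosed.exists_root D fun h0 =>
      hD0 (natDegree_eq_zero_iff_degree_le_zero.mpr h0.le)
    obtain ⟨hgr, s, hs, n, hsn⟩ := Differential.riccati_of_pole hD.ne_zero hND hg h
    replace hgr : w₂ * F.d₁ g - w₁ * F.d₂ g = _ := hgr
    obtain ⟨k, hk₁, hk₂⟩ := exists_eq_mul_of_wedge_eq_zero hw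
      (a₁ := 1 / 2 * (g * g) * e₁ + g * c₁ + f₁ - F.d₁ g)
      (a₂ := 1 / 2 * (g * g) * e₂ + g * c₂ + f₂ - F.d₂ g)
      (by linear_combination -hgr)
    have hc' : F.d₁ (g * e₂ + c₂) - F.d₂ (g * e₁ + c₁) = e₁ * (k * w₂) - e₂ * (k * w₁) := by
      rw [← hk₁, ← hk₂]
      simp only [F.d₁_add, F.d₂_add, F.d₁_mul, F.d₂_mul]
      linear_combination g * he + hc
    by_cases hk : k = 0
    · subst hk
      exact F.hasGV_of_closed (c₁ := g * e₁ + c₁) (c₂ := g * e₂ + c₂) (m := n) hω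
        (hc'.trans (by ring)) (F.d₁_natCast n) (F.d₂_natCast n) hs (hsn.trans (by ring))
    · refine .of_mul F hk ⟨-(g * e₁ + c₁), -(g * e₂ + c₂), e₁, e₂, ?_, ?_, ?_⟩
      · rw [← hk₁, ← hk₂]
        simp only [F.d₁_add, F.d₂_add, F.d₁_sub, F.d₂_sub, F.d₁_mul, F.d₂_mul, F.d₁_half,
          F.d₂_half, F.comm]
        linear_combination 1 / 2 * (g * g) * he + g * hc + hf
      · rw [F.d₁_neg, F.d₂_neg]
        linear_combination -hc'
      · linear_combination he

/-- Descent of the linear equation along an algebraic element, phrased for `HasGV`. -/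
theorem DeltaField.hasGV_of_isIntegralElem {L E : DeltaField} (ι : L.carrier →+* E.carrier)
    (h₁ : ∀ x, ι (L.d₁ x) = E.d₁ (ι x)) (h₂ : ∀ x, ι (L.d₂ x) = E.d₂ (ι x))
    {w₁ w₂ : L.carrier} (hw : ¬(w₁ = 0 ∧ w₂ = 0)) {A₁ A₂ B₁ B₂ : L.carrier}
    (hω : L.d₁ w₂ - L.d₂ w₁ = w₁ * A₂ - w₂ * A₁)
    (hα : L.d₁ A₂ - L.d₂ A₁ = w₁ * B₂ - w₂ * B₁)
    {h : E.carrier} (hint : ι.IsIntegralElem h)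
    (hh : E.tangent (ι w₁) (ι w₂) h = ι (2 * (A₁ * w₂ - A₂ * w₁)) * h +
      ι (A₁ * B₂ - A₂ * B₁ - (L.d₁ B₂ - L.d₂ B₁))) :
    L.HasGV w₁ w₂ := by
  let := ι.toAlgebra
  let : Differential L.carrier := ⟨L.tangent w₁ w₂⟩
  let : Differential E.carrier := ⟨E.tangent (ι w₁) (ι w₂)⟩
  have : DifferentialAlgebra L.carrier E.carrier := ⟨fun x => by
    change E.tangent (ι w₁) (ι w₂) (ι x) = ι (L.tangent w₁ w₂ x)
    simp only [tangent_apply, map_sub, map_mul, h₁, h₂]⟩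
  rw [L.hasGV_iff hw hω hα]
  exact Differential.exists_linear_solution_of_isAlgebraic (F := L.carrier) (M := E.carrier)
    (IsIntegral.isAlgebraic (R := L.carrier) hint) hh

/-- Elements of a simple field extension are quotients of polynomials in the generator. -/
theorem Subfield.exists_aeval_div_of_mem_closure {L E : Type} [Field L] [Field E] [Algebra L E]
    {G x : E} (hx : x ∈ Subfield.closure (((algebraMap L E).fieldRange : Set E) ∪ {G})) :
    ∃ N D : L[X], aeval G D ≠ 0 ∧ x = aeval G N / aeval G D := by
  have hle : Subfield.closure (((algebraMap L E).fieldRange : Set E) ∪ {G}) ≤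
      (IntermediateField.adjoin L {G}).toSubfield := by
    rw [Subfield.closure_le]
    rintro _ (⟨y, rfl⟩ | rfl)
    · exact IntermediateField.algebraMap_mem _ y
    · exact IntermediateField.mem_adjoin_simple_self L _
  obtain ⟨N, D, rfl⟩ := IntermediateField.mem_adjoin_simple_iff L x |>.mp (hle hx)
  by_cases h0 : aeval G D = 0
  · exact ⟨0, 1, by simp, by simp [h0]⟩
  · exact ⟨N, D, h0, rfl⟩

theorem Differential.map_implicitDeriv {L F : Type} [Field L] [Field F] [Differential L]
    [Differential F] [Algebra L F] [DifferentialAlgebra L F] (v p : L[X]) :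
    (implicitDeriv v p).map (algebraMap L F) =
      implicitDeriv (v.map (algebraMap L F)) (p.map (algebraMap L F)) := by
  have : (mapCoeffs p).map (algebraMap L F) = mapCoeffs (p.map (algebraMap L F)) := by
    ext i
    simp only [coeff_map, coeff_mapCoeffs, deriv_algebraMap]
  simp [implicitDeriv, this, derivative_map]

/-- The integrability conditions of a Riccati system with a transcendental solution. -/
theorem DeltaField.integrable_of_transcendental {L E : DeltaField} (ι : L.carrier →+* E.carrier)
    (h₁ : ∀ x, ι (L.d₁ x) = E.d₁ (ι x)) (h₂ : ∀ x, ι (L.d₂ x) = E.d₂ (ι x))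
    {G : E.carrier} {e₁ c₁ f₁ e₂ c₂ f₂ : L.carrier}
    (hG₁ : E.d₁ G = (1 / 2) * G ^ 2 * ι e₁ + G * ι c₁ + ι f₁)
    (hG₂ : E.d₂ G = (1 / 2) * G ^ 2 * ι e₂ + G * ι c₂ + ι f₂)
    (htr : ∀ p : L.carrier[X], p.eval₂ ι G = 0 → p = 0) :
    L.d₁ e₂ - L.d₂ e₁ = e₁ * c₂ - e₂ * c₁ ∧ L.d₁ c₂ - L.d₂ c₁ = e₁ * f₂ - e₂ * f₁ ∧
      L.d₁ f₂ - L.d₂ f₁ = c₁ * f₂ - c₂ * f₁ := by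
  have hcomm := E.comm G
  rw [hG₁, hG₂] at hcomm
  simp only [sq, E.d₁_add, E.d₂_add, E.d₁_mul, E.d₂_mul, E.d₁_half, E.d₂_half, hG₁, hG₂,
    ← h₁, ← h₂] at hcomm
  have hhalf : ι (1 / 2) = 1 / 2 := by rw [map_div₀, map_one, map_ofNat ι 2]
  have hcoeff (r s t : L.carrier) (h : ι r * G ^ 2 + ι s * G + ι t = 0) :
      r = 0 ∧ s = 0 ∧ t = 0 := by
    have hp := htr (C r * X ^ 2 + C s * X + C t) (by simpa using h)
    have hp2 := congrArg (coeff · 2) hp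
    have hp1 := congrArg (coeff · 1) hp
    have hp0 := congrArg (coeff · 0) hp
    simp [coeff_X, coeff_C] at hp2 hp1 hp0
    exact ⟨hp2, hp1, hp0⟩
  obtain ⟨he, hc, hf⟩ := hcoeff (1 / 2 * (L.d₁ e₂ - L.d₂ e₁ - (e₁ * c₂ - e₂ * c₁)))
    (L.d₁ c₂ - L.d₂ c₁ - (e₁ * f₂ - e₂ * f₁)) (L.d₁ f₂ - L.d₂ f₁ - (c₁ * f₂ - c₂ * f₁)) (by
      simp only [map_sub, map_mul, hhalf]
      linear_combination hcomm)
  exact ⟨by linear_combination 2 * he, sub_eq_zero.mp hc, sub_eq_zero.mp hf⟩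

/-- Descent of the linear equation along a Riccati extension. -/
theorem DeltaField.hasGV_of_riccati {L E : DeltaField} (ι : L.carrier →+* E.carrier)
    (h₁ : ∀ x, ι (L.d₁ x) = E.d₁ (ι x)) (h₂ : ∀ x, ι (L.d₂ x) = E.d₂ (ι x))
    {w₁ w₂ : L.carrier} (hw : ¬(w₁ = 0 ∧ w₂ = 0)) {A₁ A₂ B₁ B₂ : L.carrier}
    (hω : L.d₁ w₂ - L.d₂ w₁ = w₁ * A₂ - w₂ * A₁)
    (hα : L.d₁ A₂ - L.d₂ A₁ = w₁ * B₂ - w₂ * B₁)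
    {G : E.carrier} {e₁ c₁ f₁ e₂ c₂ f₂ : L.carrier}
    (hG₁ : E.d₁ G = (1 / 2) * G ^ 2 * ι e₁ + G * ι c₁ + ι f₁)
    (hG₂ : E.d₂ G = (1 / 2) * G ^ 2 * ι e₂ + G * ι c₂ + ι f₂)
    {h : E.carrier} (hmem : h ∈ Subfield.closure ((ι.fieldRange : Set E.carrier) ∪ {G}))
    (hh : E.tangent (ι w₁) (ι w₂) h = ι (2 * (A₁ * w₂ - A₂ * w₁)) * h +
      ι (A₁ * B₂ - A₂ * B₁ - (L.d₁ B₂ - L.d₂ B₁))) :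
    L.HasGV w₁ w₂ := by
  let := ι.toAlgebra
  let : Differential L.carrier := ⟨L.tangent w₁ w₂⟩
  let : Differential E.carrier := ⟨E.tangent (ι w₁) (ι w₂)⟩
  have : DifferentialAlgebra L.carrier E.carrier := ⟨fun x => by
    change E.tangent (ι w₁) (ι w₂) (ι x) = ι (L.tangent w₁ w₂ x)
    simp only [tangent_apply, map_sub, map_mul, h₁, h₂]⟩
  obtain ⟨N₀, D₀, hD₀, hND₀⟩ := Subfield.exists_aeval_div_of_mem_closure (L := L.carrier) hmem
  by_cases hG : IsAlgebraic L.carrier G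
  · refine L.hasGV_of_isIntegralElem ι h₁ h₂ hw hω hα (h := h) ?_ hh
    rw [hND₀, div_eq_mul_inv]
    have hGi : IsIntegral L.carrier G := hG.isIntegral
    have haeval (p : L.carrier[X]) : IsIntegral L.carrier (aeval G p) :=
      adjoin_le_integralClosure hGi (aeval_mem_adjoin_singleton L.carrier G)
    exact (haeval N₀).mul (haeval D₀).inv
  have htr (p : L.carrier[X]) (hp : aeval G p = 0) : p = 0 := by
    by_contra hp0
    exact hG ⟨p, hp0, hp⟩
  obtain ⟨he, hc, hf⟩ := integrable_of_transcendental ι h₁ h₂ hG₁ hG₂ htr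
  have hD₀' : D₀ ≠ 0 := by
    rintro rfl
    simp at hD₀
  obtain ⟨N, D, hDm, hcop, hND⟩ : ∃ N D : L.carrier[X], D.Monic ∧ IsCoprime N D ∧
      N * D₀ = N₀ * D := by
    let r : RatFunc L.carrier := algebraMap _ _ N₀ / algebraMap _ _ D₀
    exact ⟨r.num, r.denom, r.monic_denom, r.isCoprime_num_denom,
      (RatFunc.num_mul_eq_mul_denom_iff hD₀').mpr rfl⟩
  have hDG : aeval G D ≠ 0 := fun h0 => hDm.ne_zero (htr D h0)
  have hhG : h * aeval G D = aeval G N := by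
    have := congrArg (aeval G) hND
    simp only [map_mul] at this
    rw [hND₀]
    field_simp
    linear_combination -this
  let v : L.carrier[X] := C (1 / 2 * (e₁ * w₂ - e₂ * w₁)) * X ^ 2 +
        C (c₁ * w₂ - c₂ * w₁) * X + C (f₁ * w₂ - f₂ * w₁)
  have hhalf : ι (1 / 2) = 1 / 2 := by rw [map_div₀, map_one, map_ofNat ι 2]
  have hv : E.tangent (ι w₁) (ι w₂) G = aeval G v := by
    change _ = v.eval₂ ι G
    simp only [v, eval₂_add, eval₂_mul, eval₂_C, eval₂_X, eval₂_pow]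
    simp only [map_sub, map_mul, hhalf, tangent_apply, hG₁, hG₂]
    ring
  have hpoly : Differential.implicitDeriv v N * D - N * Differential.implicitDeriv v D =
        (C (2 * (A₁ * w₂ - A₂ * w₁)) * N +
          C (A₁ * B₂ - A₂ * B₁ - (L.d₁ B₂ - L.d₂ B₁)) * D) * D := by
    have hN := Differential.deriv_aeval_eq_implicitDeriv G v hv N
    have hD := Differential.deriv_aeval_eq_implicitDeriv G v hv D
    replace hN : E.tangent (ι w₁) (ι w₂) (aeval G N) = _ := hN
    replace hD : E.tangent (ι w₁) (ι w₂) (aeval G D) = _ := hD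
    rw [← hhG, Derivation.leibniz, hh, hD, smul_eq_mul, smul_eq_mul] at hN
    refine sub_eq_zero.mp (htr _ ?_)
    simp only [aeval_sub, aeval_add, aeval_mul, aeval_C, ← hN, ← hhG]
    change _ - (ι _ * _ + ι _ * _) * _ = 0
    ring
  obtain ⟨F, κ, _, hκ, hκ₁, hκ₂⟩ := L.exists_algebraicClosure
  let := κ.toAlgebra
  let : Differential F.carrier := ⟨F.tangent (κ w₁) (κ w₂)⟩
  have : DifferentialAlgebra L.carrier F.carrier := ⟨fun x => by
    change F.tangent (κ w₁) (κ w₂) (κ x) = κ (L.tangent w₁ w₂ x)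
    simp only [tangent_apply, map_sub, map_mul, hκ₁, hκ₂]⟩
  have hκw : ¬(κ w₁ = 0 ∧ κ w₂ = 0) := by simpa using hw
  have hω' := congrArg κ hω
  have hα' := congrArg κ hα
  have he' := congrArg κ he
  have hc' := congrArg κ hc
  have hf' := congrArg κ hf
  simp only [map_sub, map_mul, hκ₁, hκ₂] at hω' hα' he' hc' hf'
  have hκhalf : κ (1 / 2) = 1 / 2 := by rw [map_div₀, map_one, map_ofNat κ 2]
  have hmap := congrArg (Polynomial.map κ) hpoly
  have himp (p : L.carrier[X]) : (Differential.implicitDeriv v p).map κ =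
    Differential.implicitDeriv (v.map κ) (p.map κ) := Differential.map_implicitDeriv v p
  have hGV : F.HasGV (κ w₁) (κ w₂) := by
    refine F.hasGV_of_rational_solution hκw hω' hα' he' hc' hf' (hDm.map κ)
      (hcop.map (mapRingHom κ)) ?_
    simp only [Polynomial.map_sub, Polynomial.map_mul, himp, Polynomial.map_add] at hmap
    simpa [v, hκhalf, hκ₁, hκ₂, map_ofNat κ 2] using hmap
  obtain ⟨k, hk⟩ := (F.hasGV_iff hκw hω' hα').mp hGV
  refine L.hasGV_of_isIntegralElem κ hκ₁ hκ₂ hw hω hα (hκ k) ?_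
  rw [hk]
  simp only [map_sub, map_mul, hκ₁, hκ₂, map_ofNat κ 2]

/-- A differential subfield, as a Δ-field. -/
def DeltaField.restrict (E : DeltaField) (L : Subfield E.carrier) (hL : DiffSubfield E L) :
    DeltaField where
  carrier := L
  d₁ x := ⟨E.d₁ x, (hL x x.2).1⟩
  d₂ x := ⟨E.d₂ x, (hL x x.2).2⟩
  d₁_add x y := Subtype.ext (E.d₁_add x y)
  d₁_mul x y := Subtype.ext (E.d₁_mul x y)
  d₂_add x y := Subtype.ext (E.d₂_add x y)
  d₂_mul x y := Subtype.ext (E.d₂_mul x y)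
  comm x := Subtype.ext (E.comm x)

theorem AlgebraicOver.isIntegralElem {E : DeltaField} {L : Subfield E.carrier} {x : E.carrier}
    (h : AlgebraicOver E L x) : L.subtype.IsIntegralElem x := by
  obtain ⟨k, c, hc, ⟨j, hj⟩, hsum⟩ := h
  refine IsAlgebraic.isIntegral (K := L)
    ⟨∑ i, C (⟨c i, hc i⟩ : L) * X ^ (i : ℕ), fun h0 => hj ?_, ?_⟩
  · have := congrArg (fun p : L[X] => ((p.coeff j : L) : E.carrier)) h0
    simpa [finsetSum_coeff, coeff_C_mul, coeff_X_pow, Fin.val_inj] using this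
  · simpa [Algebra.algebraMap_eq_smul_one, Subfield.smul_def] using hsum

/-- Descent of a solution of the linear equation along one step of a Riccati tower. -/
theorem DeltaField.exists_solution_of_step {K E : DeltaField} (ι : K.carrier →+* E.carrier)
    (h₁ : ∀ x, ι (K.d₁ x) = E.d₁ (ι x)) (h₂ : ∀ x, ι (K.d₂ x) = E.d₂ (ι x))
    {w₁ w₂ : K.carrier} (hw : ¬(w₁ = 0 ∧ w₂ = 0)) {A₁ A₂ B₁ B₂ : K.carrier}
    (hω : K.d₁ w₂ - K.d₂ w₁ = w₁ * A₂ - w₂ * A₁)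
    (hα : K.d₁ A₂ - K.d₂ A₁ = w₁ * B₂ - w₂ * B₁)
    {L M : Subfield E.carrier} (hL : DiffSubfield E L) (hιL : ι.fieldRange ≤ L)
    (hstep : AlgStep E L M ∨ RiccatiStep E L M)
    (hM : ∃ h ∈ M, E.tangent (ι w₁) (ι w₂) h = ι (2 * (A₁ * w₂ - A₂ * w₁)) * h +
      ι (A₁ * B₂ - A₂ * B₁ - (K.d₁ B₂ - K.d₂ B₁))) :
    ∃ h ∈ L, E.tangent (ι w₁) (ι w₂) h = ι (2 * (A₁ * w₂ - A₂ * w₁)) * h +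
      ι (A₁ * B₂ - A₂ * B₁ - (K.d₁ B₂ - K.d₂ B₁)) := by
  let R := E.restrict L hL
  let σ : R.carrier →+* E.carrier := L.subtype
  let κ : K.carrier →+* R.carrier := ι.codRestrict L fun x => hιL ⟨x, rfl⟩
  have hκ₁ (x) : κ (K.d₁ x) = R.d₁ (κ x) := Subtype.ext (h₁ x)
  have hκ₂ (x) : κ (K.d₂ x) = R.d₂ (κ x) := Subtype.ext (h₂ x)
  have hκw : ¬(κ w₁ = 0 ∧ κ w₂ = 0) := by simpa using hw
  have hω' := congrArg κ hω
  have hα' := congrArg κ hα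
  simp only [map_sub, map_mul, hκ₁, hκ₂] at hω' hα'
  have ha : 2 * (κ A₁ * κ w₂ - κ A₂ * κ w₁) = κ (2 * (A₁ * w₂ - A₂ * w₁)) := by
    simp only [map_sub, map_mul, map_ofNat κ 2]
  have hb : κ A₁ * κ B₂ - κ A₂ * κ B₁ - (R.d₁ (κ B₂) - R.d₂ (κ B₁)) =
      κ (A₁ * B₂ - A₂ * B₁ - (K.d₁ B₂ - K.d₂ B₁)) := by
    simp only [map_sub, map_mul, hκ₁, hκ₂]
  obtain ⟨h, hhM, hh⟩ := hM
  replace hh : E.tangent (σ (κ w₁)) (σ (κ w₂)) h = σ (2 * (κ A₁ * κ w₂ - κ A₂ * κ w₁)) * h +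
      σ (κ A₁ * κ B₂ - κ A₂ * κ B₁ - (R.d₁ (κ B₂) - R.d₂ (κ B₁))) := by
    rw [ha, hb]
    exact hh
  have hGV : R.HasGV (κ w₁) (κ w₂) := by
    rcases hstep with hstep |
      ⟨G, e₁, c₁, f₁, e₂, c₂, f₂, he₁, hc₁, hf₁, he₂, hc₂, hf₂, hG₁, hG₂, rfl⟩
    · exact R.hasGV_of_isIntegralElem σ (fun _ => rfl) (fun _ => rfl) hκw hω' hα'
        (hstep h hhM).isIntegralElem hh
    · refine R.hasGV_of_riccati σ (fun _ => rfl) (fun _ => rfl) hκw hω' hα' (G := G)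
        (e₁ := ⟨e₁, he₁⟩) (c₁ := ⟨c₁, hc₁⟩) (f₁ := ⟨f₁, hf₁⟩)
        (e₂ := ⟨e₂, he₂⟩) (c₂ := ⟨c₂, hc₂⟩) (f₂ := ⟨f₂, hf₂⟩) hG₁ hG₂ ?_ hh
      convert hhM using 3
      exact congrArg _ L.fieldRange_subtype
  obtain ⟨k, hk⟩ := (R.hasGV_iff hκw hω' hα').mp hGV
  rw [ha, hb] at hk
  exact ⟨σ k, k.2, congrArg σ hk⟩

/-- A first integral `dH = f ω` yields a Godbillon–Vey sequence with `α = df / f`, `β = 0`. -/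
theorem DeltaField.hasGV_of_first_integral (E : DeltaField) {w₁ w₂ H : E.carrier}
    (hw : ¬(w₁ = 0 ∧ w₂ = 0)) (hH : E.d₁ H * w₂ - E.d₂ H * w₁ = 0)
    (hH0 : ¬(E.d₁ H = 0 ∧ E.d₂ H = 0)) : E.HasGV w₁ w₂ := by
  obtain ⟨f, hf₁, hf₂⟩ := exists_eq_mul_of_wedge_eq_zero hw hH
  have hf : f ≠ 0 := by
    rintro rfl
    exact hH0 ⟨by simpa using hf₁, by simpa using hf₂⟩
  have hz₁ : E.d₁ 0 = 0 := map_zero E.D₁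
  have hz₂ : E.d₂ 0 = 0 := map_zero E.D₂
  refine .of_mul E hf ⟨0, 0, 0, 0, ?_, by simp [hz₁, hz₂], by simp [hz₁, hz₂]⟩
  rw [← hf₁, ← hf₂, E.comm]
  ring

theorem DeltaField.hasGV_of_riccatiTower {K E : DeltaField} (ι : K.carrier →+* E.carrier)
    (h₁ : ∀ x, ι (K.d₁ x) = E.d₁ (ι x)) (h₂ : ∀ x, ι (K.d₂ x) = E.d₂ (ι x))
    {w₁ w₂ : K.carrier} (hw : ¬(w₁ = 0 ∧ w₂ = 0)) (hE : RiccatiTower E ι.fieldRange)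
    (hGV : E.HasGV (ι w₁) (ι w₂)) : K.HasGV w₁ w₂ := by
  obtain ⟨A₁, A₂, hω⟩ := exists_wedge_eq hw (K.d₁ w₂ - K.d₂ w₁)
  obtain ⟨B₁, B₂, hα⟩ := exists_wedge_eq hw (K.d₁ A₂ - K.d₂ A₁)
  obtain ⟨m, Ks, hKs0, hKsm, hdiff, hstep⟩ := hE
  have hmono : Monotone Ks := Fin.monotone_iff_le_succ.mpr fun i => (hstep i).1
  have hKs (i : Fin (m + 1)) : ∃ h ∈ Ks i, E.tangent (ι w₁) (ι w₂) h =
      ι (2 * (A₁ * w₂ - A₂ * w₁)) * h + ι (A₁ * B₂ - A₂ * B₁ - (K.d₁ B₂ - K.d₂ B₁)) := by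
    induction i using Fin.reverseInduction with
    | last =>
      have hω' := congrArg ι hω
      have hα' := congrArg ι hα
      simp only [map_sub, map_mul, h₁, h₂] at hω' hα'
      obtain ⟨h, hh⟩ := (E.hasGV_iff (by simpa using hw) hω' hα').mp hGV
      refine ⟨h, hKsm ▸ Subfield.mem_top h, hh.trans ?_⟩
      simp only [map_sub, map_mul, map_ofNat ι 2, h₁, h₂]
    | cast i ih =>
      exact exists_solution_of_step ι h₁ h₂ hw hω hα (hdiff _)
        (hKs0 ▸ hmono (Fin.zero_le _)) (hstep i).2 ih
  obtain ⟨h, hmem, hh⟩ := hKs 0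
  rw [hKs0] at hmem
  obtain ⟨x, rfl⟩ := hmem
  exact K.hasGV_of_isIntegralElem ι h₁ h₂ hw hω hα (ι.isIntegralElem_map) hh

/-- a foliation `ω = (w₁, w₂)` over a Δ-field `K` admits a first
integral in a Riccati tower over `K` if and only if there exist `A₁, A₂, B₁, B₂ ∈ K`
with `δ₁w₂ − δ₂w₁ = w₁A₂ − w₂A₁`, `δ₁A₂ − δ₂A₁ = w₁B₂ − w₂B₁` and
`δ₁B₂ − δ₂B₁ = A₁B₂ − A₂B₁` (1-forms `α, β` with `dω = ω ∧ α`, `dα = ω ∧ β`,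
`dβ = α ∧ β`: a Godbillon-Vey sequence of length three). -/
theorem riccati_first_integral_iff_length_three_GV
    (K : DeltaField) (w₁ w₂ : K.carrier) (hw : ¬(w₁ = 0 ∧ w₂ = 0)) :
    (∃ (E : DeltaField) (ι : K.carrier →+* E.carrier),
      (∀ x, ι (K.d₁ x) = E.d₁ (ι x)) ∧ (∀ x, ι (K.d₂ x) = E.d₂ (ι x)) ∧
      RiccatiTower E ι.fieldRange ∧
      ∃ H : E.carrier,
        E.d₁ H * ι w₂ - E.d₂ H * ι w₁ = 0 ∧ ¬(E.d₁ H = 0 ∧ E.d₂ H = 0)) ↔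
    (∃ A₁ A₂ B₁ B₂ : K.carrier,
      K.d₁ w₂ - K.d₂ w₁ = w₁ * A₂ - w₂ * A₁ ∧
      K.d₁ A₂ - K.d₂ A₁ = w₁ * B₂ - w₂ * B₁ ∧
      K.d₁ B₂ - K.d₂ B₁ = A₁ * B₂ - A₂ * B₁) := by
  constructor
  · rintro ⟨E, ι, h₁, h₂, hE, H, hH, hH0⟩
    exact DeltaField.hasGV_of_riccatiTower ι h₁ h₂ hw hE
      (E.hasGV_of_first_integral (by simpa using hw) hH hH0)
  · rintro ⟨A₁, A₂, B₁, B₂, hω, hα, hβ⟩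
    exact K.exists_first_integral_of_GV w₁ w₂ hw A₁ A₂ B₁ B₂ hω hα hβ
end

section
/- Let E be a Δ-field, L ⊆ E a differential subfield, and w₁, w₂ ∈ L. Let H ∈ E be algebraic over L with δ₁H·w₂ − δ₂H·w₁ = 0, and let X^p + a_{p−1}X^{p−1} + … + a₀ (with a₀, …, a_{p−1} ∈ L) be the minimal polynomial of H over L. Then every coefficient is a first integral of ω: δ₁aᵢ·w₂ − δ₂aᵢ·w₁ = 0 for all 0 ≤ i ≤ p−1. -/
open scoped BigOperators

/-- `d₁`, `d₂` make the field `E` a Δ-field: two commuting derivations. -/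
structure IsDeltaField {E : Type*} [Field E] (d₁ d₂ : E → E) : Prop where
  add₁ : ∀ x y, d₁ (x + y) = d₁ x + d₁ y
  mul₁ : ∀ x y, d₁ (x * y) = d₁ x * y + x * d₁ y
  add₂ : ∀ x y, d₂ (x + y) = d₂ x + d₂ y
  mul₂ : ∀ x y, d₂ (x * y) = d₂ x * y + x * d₂ y
  comm : ∀ x, d₁ (d₂ x) = d₂ (d₁ x)

/-- The derivation `x ↦ δ₁x·w₂ − δ₂x·w₁`, whose constants are the first integrals of `(w₁, w₂)`. -/
def IsDeltaField.wedgeDerivation {E : Type*} [Field E] {d₁ d₂ : E → E}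
    (hE : IsDeltaField d₁ d₂) (w₁ w₂ : E) : Derivation ℤ E E :=
  Derivation.mk'
    (AddMonoidHom.mk' (fun x => d₁ x * w₂ - d₂ x * w₁)
      (fun x y => by rw [hE.add₁, hE.add₂]; ring)).toIntLinearMap
    (fun x y => by
      simp only [AddMonoidHom.coe_toIntLinearMap, AddMonoidHom.mk'_apply, smul_eq_mul,
        hE.mul₁, hE.mul₂]
      ring)

/-- if `H` is algebraic over a differential subfield `L` containing
`w₁, w₂`, `H` is a first integral of `ω = (w₁, w₂)` (i.e. `δ₁H·w₂ − δ₂H·w₁ = 0`), and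
`X^p + a_{p−1}X^{p−1} + … + a₀` is the minimal polynomial of `H` over `L`, then every
coefficient `aᵢ` is also a first integral of `ω`. -/
theorem min_poly_coeffs_are_first_integrals
    {E : Type} [Field E] [CharZero E] (d₁ d₂ : E → E)
    (hE : IsDeltaField d₁ d₂)
    (L : Subfield E) (hL : ∀ x ∈ L, d₁ x ∈ L ∧ d₂ x ∈ L)
    (w₁ w₂ : E) (hw₁ : w₁ ∈ L) (hw₂ : w₂ ∈ L)
    (H : E) (hH : d₁ H * w₂ - d₂ H * w₁ = 0)
    (p : ℕ) (hp : 0 < p)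
    (a : Fin p → E) (ha : ∀ i, a i ∈ L)
    (hroot : H ^ p + ∑ i, a i * H ^ (i : ℕ) = 0)
    (hminimal : ∀ c : Fin p → E, (∀ i, c i ∈ L) →
      (∑ i, c i * H ^ (i : ℕ)) = 0 → ∀ i, c i = 0) :
    ∀ i, d₁ (a i) * w₂ - d₂ (a i) * w₁ = 0 := by
  set D := hE.wedgeDerivation w₁ w₂
  have hDH : D H = 0 := hH
  have hDpow (n : ℕ) : D (H ^ n) = 0 := by simp [D.leibniz_pow, hDH]
  refine hminimal (fun i => D (a i))
    (fun i => L.sub_mem (L.mul_mem (hL _ (ha i)).1 hw₂) (L.mul_mem (hL _ (ha i)).2 hw₁)) ?_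
  simpa [hDpow, D.leibniz, mul_comm] using congrArg D hroot
end

section
/- Let E be a Δ-field, L ⊆ E a differential subfield, and w₁, w₂ ∈ L. Let G ∈ E be transcendental over L with δ₁G ∈ L and δ₂G ∈ L, and let F = Σ_{i=0}^{k} aᵢ·Gⁱ with a₀, …, a_k ∈ L and a_k ≠ 0. If F satisfies the integrating-factor equation d(F·ω) = 0, i.e. δ₁F·w₂ − δ₂F·w₁ + F·(δ₁w₂ − δ₂w₁) = 0, then its top coefficient does too: δ₁a_k·w₂ − δ₂a_k·w₁ + a_k·(δ₁w₂ − δ₂w₁) = 0. -/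
open scoped BigOperators

/-- The first-order operator `x ↦ D x + x * c` applied to a polynomial expression in `G`,
expanded in powers of `G`: the derivative of `G` shifts each coefficient down by one. -/
theorem Derivation.apply_sum_mul_pow_add_mul {R : Type*} [CommRing R] (D : Derivation ℤ R R)
    (c G : R) {k : ℕ} (a : Fin (k + 1) → R) :
    D (∑ i, a i * G ^ (i : ℕ)) + (∑ i, a i * G ^ (i : ℕ)) * c =
      ∑ j, (D (a j) + a j * c + Fin.snoc (α := fun _ => R)
        (fun i : Fin k => ((i : ℕ) + 1 : R) * a i.succ * D G) 0 j) * G ^ (j : ℕ) := by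
  have hshift : ∑ j : Fin (k + 1), Fin.snoc (α := fun _ => R)
        (fun i : Fin k => ((i : ℕ) + 1 : R) * a i.succ * D G) 0 j * G ^ (j : ℕ) =
      ∑ i : Fin (k + 1), a i * ((i : ℕ) * G ^ ((i : ℕ) - 1) * D G) := by
    rw [Fin.sum_univ_castSucc, Fin.sum_univ_succ]
    simp only [Fin.snoc_castSucc, Fin.snoc_last, Fin.val_castSucc, Fin.val_succ, Fin.val_zero]
    simp only [Nat.cast_zero, zero_mul, mul_zero, add_zero, zero_add, Nat.cast_add, Nat.cast_one,
      Nat.add_sub_cancel]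
    exact Finset.sum_congr rfl fun i _ => by ring
  simp only [add_mul (D _ + _ * c), Finset.sum_add_distrib, hshift]
  rw [map_sum, Finset.sum_mul, ← Finset.sum_add_distrib, ← Finset.sum_add_distrib]
  refine Finset.sum_congr rfl fun i _ => ?_
  simp only [Derivation.leibniz, Derivation.leibniz_pow, smul_eq_mul, nsmul_eq_mul]
  ring

/-- let `G` be transcendental over a differential subfield `L`
containing `w₁, w₂`, with `δ₁G ∈ L`, `δ₂G ∈ L`, and let `F = Σᵢ aᵢ·Gⁱ` with
coefficients in `L`, `a_k ≠ 0`. If `F` is an integrating factor for `ω = (w₁, w₂)`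
(i.e. `δ₁F·w₂ − δ₂F·w₁ + F·(δ₁w₂ − δ₂w₁) = 0`), then so is its top coefficient `a_k`. -/
theorem top_coeff_is_integrating_factor
    {E : Type} [Field E] [CharZero E] (d₁ d₂ : E → E)
    (hE : IsDeltaField d₁ d₂)
    (L : Subfield E) (hL : ∀ x ∈ L, d₁ x ∈ L ∧ d₂ x ∈ L)
    (w₁ w₂ : E) (hw₁ : w₁ ∈ L) (hw₂ : w₂ ∈ L)
    (G : E) (hG1 : d₁ G ∈ L) (hG2 : d₂ G ∈ L)
    (htrans : ∀ (m : ℕ) (c : Fin (m + 1) → E), (∀ j, c j ∈ L) →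
      ∑ j, c j * G ^ (j : ℕ) = 0 → ∀ j, c j = 0)
    (k : ℕ) (a : Fin (k + 1) → E) (ha : ∀ i, a i ∈ L)
    (hak : a (Fin.last k) ≠ 0)
    (F : E) (hF : F = ∑ i, a i * G ^ (i : ℕ))
    (hint : d₁ F * w₂ - d₂ F * w₁ + F * (d₁ w₂ - d₂ w₁) = 0) :
    d₁ (a (Fin.last k)) * w₂ - d₂ (a (Fin.last k)) * w₁
      + a (Fin.last k) * (d₁ w₂ - d₂ w₁) = 0 := by
  let D : Derivation ℤ E E := Derivation.mk'
    (AddMonoidHom.mk' (fun x => d₁ x * w₂ - d₂ x * w₁)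
      fun x y => by rw [hE.add₁, hE.add₂]; ring).toIntLinearMap
    fun x y => by
      change d₁ (x * y) * w₂ - d₂ (x * y) * w₁ =
        x * (d₁ y * w₂ - d₂ y * w₁) + y * (d₁ x * w₂ - d₂ x * w₁)
      rw [hE.mul₁, hE.mul₂]
      ring
  have hDL : ∀ x, d₁ x ∈ L → d₂ x ∈ L → D x ∈ L := fun x h₁ h₂ =>
    L.sub_mem (L.mul_mem h₁ hw₂) (L.mul_mem h₂ hw₁)
  have hc : d₁ w₂ - d₂ w₁ ∈ L := L.sub_mem (hL w₂ hw₂).1 (hL w₁ hw₁).2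
  change D F + F * (d₁ w₂ - d₂ w₁) = 0 at hint
  rw [hF, Derivation.apply_sum_mul_pow_add_mul] at hint
  have hlast := htrans k _ (fun j => ?_) hint (Fin.last k)
  · rw [Fin.snoc_last, add_zero] at hlast
    exact hlast
  · refine L.add_mem (L.add_mem (hDL _ (hL _ (ha j)).1 (hL _ (ha j)).2)
      (L.mul_mem (ha j) hc)) ?_
    induction j using Fin.lastCases with
    | last => rw [Fin.snoc_last]; exact L.zero_mem
    | cast i =>
      rw [Fin.snoc_castSucc]
      exact L.mul_mem (L.mul_mem (L.add_mem (natCast_mem L _) L.one_mem) (ha _))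
        (hDL G hG1 hG2)
end

section
/- Let E be a Δ-field, k a positive integer, and m, w₁, w₂ ∈ E all nonzero. Suppose H₁, H₂ ∈ E both satisfy the system (dH)^{⊗k} = m·ω^{⊗k} together with dH ∧ ω = 0, i.e. for ℓ = 1, 2: (δ₁H_ℓ)^k = m·w₁^k, (δ₂H_ℓ)^k = m·w₂^k, and δ₁H_ℓ·w₂ − δ₂H_ℓ·w₁ = 0. Then there exist constants θ, b ∈ E (δ₁θ = δ₂θ = δ₁b = δ₂b = 0) with θ^k = 1 and H₁ = θ·H₂ + b. -/
/-- The power rule for a map satisfying the Leibniz rule. -/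
theorem leibniz_pow_succ {R : Type*} [CommRing R] {d : R → R}
    (hmul : ∀ x y, d (x * y) = d x * y + x * d y) (x : R) (n : ℕ) :
    d (x ^ (n + 1)) = (n + 1) * x ^ n * d x := by
  induction n with
  | zero => simp
  | succ n ih =>
    rw [pow_succ, hmul, ih]
    push_cast
    ring

/-- In characteristic zero, a map satisfying the Leibniz rule kills roots of unity. -/
theorem leibniz_eq_zero_of_pow_eq_one {E : Type*} [Field E] [CharZero E] {d : E → E}
    (hmul : ∀ x y, d (x * y) = d x * y + x * d y) {θ : E} {k : ℕ} (hk : 0 < k)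
    (hθ : θ ^ k = 1) : d θ = 0 := by
  obtain ⟨n, rfl⟩ := Nat.exists_eq_add_of_lt hk
  rw [zero_add] at hθ
  have hone : d 1 = 0 := by simpa using hmul 1 1
  have hθ0 : θ ≠ 0 := by
    rintro rfl
    simp at hθ
  have h := leibniz_pow_succ hmul θ n
  rw [hθ, hone] at h
  have hn : (n + 1 : E) ≠ 0 := by exact_mod_cast n.succ_ne_zero
  exact (mul_eq_zero.mp h.symm).resolve_left (mul_ne_zero hn (pow_ne_zero n hθ0))

/-- If `d θ = 0` and `d H₁ = θ * d H₂`, then `H₁ - θ * H₂` is killed by `d`. -/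
theorem leibniz_sub_mul_eq_zero {R : Type*} [CommRing R] {d : R → R}
    (hadd : ∀ x y, d (x + y) = d x + d y)
    (hmul : ∀ x y, d (x * y) = d x * y + x * d y) {θ H₁ H₂ : R}
    (hθ : d θ = 0) (h : d H₁ = θ * d H₂) : d (H₁ - θ * H₂) = 0 := by
  have hsum := hadd (H₁ - θ * H₂) (θ * H₂)
  rw [sub_add_cancel, hmul, hθ, h] at hsum
  linear_combination -hsum

/-- if `H₁` and `H₂` both satisfy the system `(dH)^{⊗k} = m·ω^{⊗k}`,
`dH ∧ ω = 0` in a Δ-field (with `m, w₁, w₂` nonzero), then `H₁ = θ·H₂ + b` for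
constants `θ, b` with `θ^k = 1`. -/
theorem darboux_case_galois_group
    {E : Type} [Field E] [CharZero E] (d₁ d₂ : E → E)
    (hE : IsDeltaField d₁ d₂)
    (k : ℕ) (hk : 0 < k)
    (m w₁ w₂ : E) (hm : m ≠ 0) (hw₁ : w₁ ≠ 0) (hw₂ : w₂ ≠ 0)
    (H₁ H₂ : E)
    (h11 : (d₁ H₁) ^ k = m * w₁ ^ k) (h12 : (d₂ H₁) ^ k = m * w₂ ^ k)
    (h13 : d₁ H₁ * w₂ - d₂ H₁ * w₁ = 0)
    (h21 : (d₁ H₂) ^ k = m * w₁ ^ k) (h22 : (d₂ H₂) ^ k = m * w₂ ^ k)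
    (h23 : d₁ H₂ * w₂ - d₂ H₂ * w₁ = 0) :
    ∃ θ b : E, d₁ θ = 0 ∧ d₂ θ = 0 ∧ d₁ b = 0 ∧ d₂ b = 0 ∧
      θ ^ k = 1 ∧ H₁ = θ * H₂ + b := by
  have hne : d₁ H₂ ≠ 0 := by
    intro h
    rw [h, zero_pow hk.ne'] at h21
    exact mul_ne_zero hm (pow_ne_zero k hw₁) h21.symm
  obtain ⟨θ, hθ⟩ : ∃ θ, d₁ H₁ = θ * d₁ H₂ := ⟨d₁ H₁ / d₁ H₂, (div_mul_cancel₀ _ hne).symm⟩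
  have hθk : θ ^ k = 1 := by
    have h : θ ^ k * d₁ H₂ ^ k = 1 * d₁ H₂ ^ k := by rw [← mul_pow, ← hθ, h11, h21, one_mul]
    exact mul_right_cancel₀ (pow_ne_zero k hne) h
  have hθ' : d₂ H₁ = θ * d₂ H₂ := by
    apply mul_right_cancel₀ hw₁
    linear_combination w₂ * hθ - h13 + θ * h23
  have hθ₁ := leibniz_eq_zero_of_pow_eq_one hE.mul₁ hk hθk
  have hθ₂ := leibniz_eq_zero_of_pow_eq_one hE.mul₂ hk hθk
  exact ⟨θ, H₁ - θ * H₂, hθ₁, hθ₂, leibniz_sub_mul_eq_zero hE.add₁ hE.mul₁ hθ₁ hθ,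
    leibniz_sub_mul_eq_zero hE.add₂ hE.mul₂ hθ₂ hθ', hθk, by ring⟩
end

section
/- Let E be a Δ-field, w₁, w₂ ∈ E nonzero, and a₁, a₂ ∈ E. Suppose H₁, H₂ ∈ E satisfy, for ℓ = 1, 2: δ₁H_ℓ ≠ 0, δ₂H_ℓ ≠ 0, δ₁H_ℓ·w₂ − δ₂H_ℓ·w₁ = 0, and δⱼ(δⱼH_ℓ)/δⱼH_ℓ = aⱼ + δⱼwⱼ/wⱼ for j = 1, 2. Then there exist constants a, b ∈ E (δ₁a = δ₂a = δ₁b = δ₂b = 0) with a ≠ 0 and H₁ = a·H₂ + b. -/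
/-- A ratio of two elements with the same logarithmic derivative is a constant. -/
theorem leibniz_ratio_eq_zero {E : Type*} [Field E] {d : E → E}
    (hmul : ∀ x y, d (x * y) = d x * y + x * d y) {a x y : E}
    (hx : x ≠ 0) (hy : y ≠ 0) (hxy : x = a * y) (hlog : d x / x = d y / y) :
    d a = 0 := by
  rw [div_eq_div_iff hx hy, hxy, hmul] at hlog
  have h : d a * (y * y) = 0 := by linear_combination hlog
  exact (mul_eq_zero.mp h).resolve_right (mul_ne_zero hy hy)

/-- If `a` is a constant and `d H = a * d K`, then `H - a * K` is a constant. -/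
theorem leibniz_sub_const_mul_eq_zero {E : Type*} [Field E] {d : E → E}
    (hadd : ∀ x y, d (x + y) = d x + d y)
    (hmul : ∀ x y, d (x * y) = d x * y + x * d y) {a H K : E}
    (ha : d a = 0) (hHK : d H = a * d K) : d (H - a * K) = 0 := by
  have h := hadd (H - a * K) (a * K)
  rw [sub_add_cancel, hmul, ha] at h
  linear_combination hHK - h

/-- if `H₁` and `H₂` both satisfy the system of a first integral with
affine monodromy (`δ₁H·w₂ − δ₂H·w₁ = 0` and `δⱼ(δⱼH)/δⱼH = aⱼ + δⱼwⱼ/wⱼ` for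
`j = 1, 2`), then `H₁ = a·H₂ + b` for constants `a ≠ 0` and `b`. -/
theorem liouville_case_galois_group
    {E : Type} [Field E] [CharZero E] (d₁ d₂ : E → E)
    (hE : IsDeltaField d₁ d₂)
    (w₁ w₂ : E) (hw₁ : w₁ ≠ 0) (hw₂ : w₂ ≠ 0)
    (a₁ a₂ : E)
    (H₁ H₂ : E)
    (h10 : d₁ H₁ ≠ 0) (h10' : d₂ H₁ ≠ 0)
    (h11 : d₁ H₁ * w₂ - d₂ H₁ * w₁ = 0)
    (h12 : d₁ (d₁ H₁) / d₁ H₁ = a₁ + d₁ w₁ / w₁)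
    (h13 : d₂ (d₂ H₁) / d₂ H₁ = a₂ + d₂ w₂ / w₂)
    (h20 : d₁ H₂ ≠ 0) (h20' : d₂ H₂ ≠ 0)
    (h21 : d₁ H₂ * w₂ - d₂ H₂ * w₁ = 0)
    (h22 : d₁ (d₁ H₂) / d₁ H₂ = a₁ + d₁ w₁ / w₁)
    (h23 : d₂ (d₂ H₂) / d₂ H₂ = a₂ + d₂ w₂ / w₂) :
    ∃ a b : E, d₁ a = 0 ∧ d₂ a = 0 ∧ d₁ b = 0 ∧ d₂ b = 0 ∧
      a ≠ 0 ∧ H₁ = a * H₂ + b := by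
  have e₁ : d₁ H₁ = d₁ H₁ / d₁ H₂ * d₁ H₂ := (div_mul_cancel₀ _ h20).symm
  have e₂ : d₂ H₁ = d₁ H₁ / d₁ H₂ * d₂ H₂ := by
    rw [div_mul_eq_mul_div, eq_div_iff h20]
    refine mul_right_cancel₀ (mul_ne_zero hw₁ hw₂) ?_
    linear_combination d₂ H₁ * w₁ * h21 - d₂ H₂ * w₁ * h11
  have c₁ := leibniz_ratio_eq_zero hE.mul₁ h10 h20 e₁ (h12.trans h22.symm)
  have c₂ := leibniz_ratio_eq_zero hE.mul₂ h10' h20' e₂ (h13.trans h23.symm)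
  exact ⟨d₁ H₁ / d₁ H₂, H₁ - d₁ H₁ / d₁ H₂ * H₂, c₁, c₂,
    leibniz_sub_const_mul_eq_zero hE.add₁ hE.mul₁ c₁ e₁,
    leibniz_sub_const_mul_eq_zero hE.add₂ hE.mul₂ c₂ e₂,
    div_ne_zero h10 h20, (add_sub_cancel _ _).symm⟩
end

section
/- Let E be a Δ-field, w₁, w₂ ∈ E nonzero, a₁, a₂ ∈ E, and R₁, R₂ ∈ E. Suppose H₁, H₂ ∈ E satisfy, for ℓ = 1, 2: δ₁H_ℓ ≠ 0, δ₂H_ℓ ≠ 0, δ₁H_ℓ/w₁ = δ₂H_ℓ/w₂, (1/w₁)·(δ₁(δ₁H_ℓ)/δ₁H_ℓ − δ₁w₁/w₁ − a₁) = (1/w₂)·(δ₂(δ₂H_ℓ)/δ₂H_ℓ − δ₂w₂/w₂ − a₂), and for j = 1, 2: δⱼ(δⱼ(δⱼH_ℓ)/δⱼH_ℓ) − ½·(δⱼ(δⱼH_ℓ)/δⱼH_ℓ)² = Rⱼ. Then there exist constants a, b, c, d ∈ E (killed by δ₁ and δ₂) with a·d − b·c ≠ 0, c·H₂ + d ≠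 0, and H₁ = (a·H₂ + b)/(c·H₂ + d). -/
/-- An additive map satisfying the Leibniz rule is a derivation over `ℤ`. -/
theorem exists_derivation_of_add_of_leibniz {E : Type*} [Field E] {d : E → E}
    (hadd : ∀ x y, d (x + y) = d x + d y) (hmul : ∀ x y, d (x * y) = d x * y + x * d y) :
    ∃ D : Derivation ℤ E E, d = D :=
  ⟨Derivation.mk' (AddMonoidHom.mk' d hadd).toIntLinearMap fun x y => by
    change d (x * y) = x • d y + y • d x
    rw [hmul, smul_eq_mul, smul_eq_mul]; ring, rfl⟩

section Schwarzian

variable {E : Type*} [Field E] (D : Derivation ℤ E E) {F G f p : E}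

/-- The logarithmic derivative of `D F` when `D F = f * D G`. -/
theorem logDeriv_eq_add (hf : f ≠ 0) (hG : D G ≠ 0) (hF : D F = f * D G) :
    D (D F) / D F = D f / f + D (D G) / D G := by
  rw [hF, D.leibniz, smul_eq_mul, smul_eq_mul]
  field_simp
  ring

/-- If `F` and `G` have the same Schwarzian, the coefficient `p` of the logarithmic derivative of
`D F / D G` with respect to `G` satisfies a Riccati equation. -/
theorem riccati_of_schwarzian_eq [CharZero E] (hf : f ≠ 0) (hG : D G ≠ 0) (hF : D F = f * D G)
    (hfp : D f / f = p * D G)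
    (hS : D (D (D F) / D F) - (1 / 2) * (D (D F) / D F) ^ 2 =
      D (D (D G) / D G) - (1 / 2) * (D (D G) / D G) ^ 2) :
    D p = p ^ 2 * D G / 2 := by
  rw [logDeriv_eq_add D hf hG hF, hfp, map_add, D.leibniz, smul_eq_mul, smul_eq_mul] at hS
  have hu : D (D G) = D (D G) / D G * D G := by field_simp
  generalize D (D G) / D G = u at hS hu
  rw [hu] at hS
  apply mul_right_cancel₀ hG
  linear_combination hS

/-- The three constants of a solution of the Riccati equation with `p ≠ 0`. -/
theorem constants_of_riccati [CharZero E] (hp : p ≠ 0) (hF : D F = f * D G) (hf : D f = p * D G * f)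
    (hpD : D p = p ^ 2 * D G / 2) :
    D (2 * p⁻¹ + G) = 0 ∧ D (f * (p⁻¹ * p⁻¹)) = 0 ∧ D (F - 2 * (f * p⁻¹)) = 0 := by
  have h2 : D (2 : E) = 0 := by exact_mod_cast D.map_natCast 2
  have hi : D p⁻¹ = -(D G / 2) := by
    rw [D.leibniz_inv, hpD, smul_eq_mul]; field_simp
  refine ⟨?_, ?_, ?_⟩ <;>
    simp only [map_add, map_sub, D.leibniz, smul_eq_mul, h2, hi, hf, hF] <;> field_simp <;> ring

end Schwarzian

/-- if `H₁` and `H₂` both satisfy the system of a first integral with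
projective monodromy (proportionality `δ₁H/w₁ = δ₂H/w₂`, equality of the two
normalized affine coefficients, and the two Schwarzian-type equations with prescribed
right-hand sides `R₁, R₂`), then `H₁ = (a·H₂ + b)/(c·H₂ + d)` for constants
`a, b, c, d` with `ad − bc ≠ 0`. -/
theorem riccati_case_galois_group
    {E : Type} [Field E] [CharZero E] (d₁ d₂ : E → E)
    (hE : IsDeltaField d₁ d₂)
    (w₁ w₂ : E) (hw₁ : w₁ ≠ 0) (hw₂ : w₂ ≠ 0)
    (a₁ a₂ R₁ R₂ : E)
    (H₁ H₂ : E)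
    (h10 : d₁ H₁ ≠ 0) (h10' : d₂ H₁ ≠ 0)
    (h11 : d₁ H₁ / w₁ = d₂ H₁ / w₂)
    (h12 : (1 / w₁) * (d₁ (d₁ H₁) / d₁ H₁ - d₁ w₁ / w₁ - a₁)
         = (1 / w₂) * (d₂ (d₂ H₁) / d₂ H₁ - d₂ w₂ / w₂ - a₂))
    (h13 : d₁ (d₁ (d₁ H₁) / d₁ H₁) - (1 / 2) * (d₁ (d₁ H₁) / d₁ H₁) ^ 2 = R₁)
    (h14 : d₂ (d₂ (d₂ H₁) / d₂ H₁) - (1 / 2) * (d₂ (d₂ H₁) / d₂ H₁) ^ 2 = R₂)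
    (h20 : d₁ H₂ ≠ 0) (h20' : d₂ H₂ ≠ 0)
    (h21 : d₁ H₂ / w₁ = d₂ H₂ / w₂)
    (h22 : (1 / w₁) * (d₁ (d₁ H₂) / d₁ H₂ - d₁ w₁ / w₁ - a₁)
         = (1 / w₂) * (d₂ (d₂ H₂) / d₂ H₂ - d₂ w₂ / w₂ - a₂))
    (h23 : d₁ (d₁ (d₁ H₂) / d₁ H₂) - (1 / 2) * (d₁ (d₁ H₂) / d₁ H₂) ^ 2 = R₁)
    (h24 : d₂ (d₂ (d₂ H₂) / d₂ H₂) - (1 / 2) * (d₂ (d₂ H₂) / d₂ H₂) ^ 2 = R₂) :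
    ∃ a b c d : E,
      d₁ a = 0 ∧ d₂ a = 0 ∧ d₁ b = 0 ∧ d₂ b = 0 ∧
      d₁ c = 0 ∧ d₂ c = 0 ∧ d₁ d = 0 ∧ d₂ d = 0 ∧
      a * d - b * c ≠ 0 ∧ c * H₂ + d ≠ 0 ∧
      H₁ = (a * H₂ + b) / (c * H₂ + d) := by
  obtain ⟨D₁, rfl⟩ := exists_derivation_of_add_of_leibniz hE.add₁ hE.mul₁
  obtain ⟨D₂, rfl⟩ := exists_derivation_of_add_of_leibniz hE.add₂ hE.mul₂
  obtain ⟨f, hF₁⟩ : ∃ f, D₁ H₁ = f * D₁ H₂ := ⟨D₁ H₁ / D₁ H₂, by field_simp⟩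
  have hf : f ≠ 0 := by rintro rfl; simp [hF₁] at h10
  have hw : D₂ H₂ = w₂ / w₁ * D₁ H₂ := by field_simp at h21 ⊢; linear_combination -h21
  have hF₂ : D₂ H₁ = f * D₂ H₂ := by
    rw [hw]; rw [hF₁] at h11; field_simp at h11 ⊢; linear_combination -h11
  obtain ⟨p, hp₁⟩ : ∃ p, D₁ f / f = p * D₁ H₂ := ⟨D₁ f / f / D₁ H₂, by field_simp⟩
  have hp₂ : D₂ f / f = p * D₂ H₂ := by
    rw [logDeriv_eq_add D₁ hf h20 hF₁, logDeriv_eq_add D₂ hf h20' hF₂, hp₁] at h12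
    have h : 1 / w₁ * (p * D₁ H₂) = 1 / w₂ * (D₂ f / f) := by linear_combination h12 - h22
    rw [hw]
    generalize D₂ f / f = q at h ⊢
    field_simp at h ⊢
    linear_combination -h
  have hr₁ := riccati_of_schwarzian_eq D₁ hf h20 hF₁ hp₁ (h13.trans h23.symm)
  have hr₂ := riccati_of_schwarzian_eq D₂ hf h20' hF₂ hp₂ (h14.trans h24.symm)
  rw [div_eq_iff hf] at hp₁ hp₂
  by_cases hp : p = 0
  · have hf₁ : D₁ f = 0 := by simp [hp₁, hp]
    have hf₂ : D₂ f = 0 := by simp [hp₂, hp]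
    refine ⟨f, H₁ - f * H₂, 0, 1, hf₁, hf₂, ?_, ?_, ?_, ?_, ?_, ?_, ?_, ?_, ?_⟩ <;>
      simp [hf₁, hf₂, hF₁, hF₂, hf]
  · obtain ⟨hk₁, hm₁, hn₁⟩ := constants_of_riccati D₁ hp hF₁ hp₁ hr₁
    obtain ⟨hk₂, hm₂, hn₂⟩ := constants_of_riccati D₂ hp hF₂ hp₂ hr₂
    have hm : f * (p⁻¹ * p⁻¹) ≠ 0 := by simp [hf, hp]
    have hk : 2 * p⁻¹ ≠ 0 := by simp [hp]
    have hH : H₁ = H₁ - 2 * (f * p⁻¹) + 4 * (f * (p⁻¹ * p⁻¹)) / (2 * p⁻¹) := by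
      field_simp; ring
    have hc : (2 * p⁻¹ + H₂) - H₂ ≠ 0 := by simpa using hk
    have hH' : H₁ = H₁ - 2 * (f * p⁻¹) + 4 * (f * (p⁻¹ * p⁻¹)) / ((2 * p⁻¹ + H₂) - H₂) := by
      rwa [add_sub_cancel_right]
    generalize f * (p⁻¹ * p⁻¹) = m at *
    generalize H₁ - 2 * (f * p⁻¹) = n at *
    generalize 2 * p⁻¹ + H₂ = k at *
    have h4₁ : D₁ (4 : E) = 0 := by exact_mod_cast D₁.map_natCast 4
    have h4₂ : D₂ (4 : E) = 0 := by exact_mod_cast D₂.map_natCast 4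
    refine ⟨-n, 4 * m + n * k, -1, k, ?_, ?_, ?_, ?_, ?_, ?_, hk₁, hk₂, ?_, ?_, ?_⟩
    any_goals simp [hn₁, hn₂, hk₁, hk₂, hm₁, hm₂, h4₁, h4₂]
    · simpa using hm
    · contrapose! hc; linear_combination hc
    · have hc' : -H₂ + k ≠ 0 := by contrapose! hc; linear_combination hc
      rw [eq_div_iff hc', hH']
      field_simp
      ring
end
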